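/- arXiv:1401.2249 — 2 statements merged into one kernel-verified Lean document; each statement's English description precedes it below -/
import Mathlib

section
/- There exists a C^∞ function f : ℂ² → ℝ such that, letting G = 𝒢_f(Γ) = {(z_1, z_2, f(z_1,z_2)) : (z_1,z_2) ∈ Γ} ⊆ ℂ³ be the graph of f over the torus Γ, the polynomially convex hull Ĝ strictly contains G, and Ĝ contains no analytic disk. -/
open Metric

noncomputable def polyHull {m : ℕ} (K : Set (Fin m → ℂ)) : Set (Fin m → ℂ) :=
  {z | ∀ p : MvPolynomial (Fin m) ℂ,
    ‖MvPolynomial.eval z p‖ ≤ sSup ((fun w => ‖MvPolynomial.eval w p‖) '' K)}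

def NoAnalyticDisk {m : ℕ} (S : Set (Fin m → ℂ)) : Prop :=
  ∀ φ : ℂ → (Fin m → ℂ), DifferentiableOn ℂ φ (ball (0:ℂ) 1) →
    (∀ z ∈ ball (0:ℂ) 1, φ z ∈ S) →
    ∀ z ∈ ball (0:ℂ) 1, ∀ w ∈ ball (0:ℂ) 1, φ z = φ w

/-- The unit torus, the distinguished boundary of the bidisk. -/
def Torus : Set (Fin 2 → ℂ) := {z | ‖z 0‖ = 1 ∧ ‖z 1‖ = 1}

/-- The graph of a real-valued function over a subset of `ℂ²`, inside `ℂ³`. -/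
noncomputable def graphR (f : (Fin 2 → ℂ) → ℝ) (E : Set (Fin 2 → ℂ)) :
    Set (Fin 3 → ℂ) :=
  (fun z => (Fin.snoc z ((f z : ℂ)) : Fin 3 → ℂ)) '' E


open Polynomial in
/-- One step of the construction. -/
noncomputable def wStep (a : ℂ) (n : ℕ) (p : ℂ[X][X]) (s : ℝ) : ℂ[X][X] :=
  p ^ 2 - C (C ((s : ℂ) ^ 4) * X ^ (2 ^ (n + 1) - 1) * (X - C a) *
    (1 - C ((starRingEnd ℂ) a) * X)) * X ^ (2 ^ (n + 1))

open Polynomial in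
theorem wStep_eval (a : ℂ) (n : ℕ) (p : ℂ[X][X]) (s : ℝ) (z w : ℂ) :
    (wStep a n p s).evalEval z w = (p.evalEval z w) ^ 2 -
      (s : ℂ) ^ 4 * z ^ (2 ^ (n + 1) - 1) * (z - a) * (1 - (starRingEnd ℂ) a * z) *
        w ^ (2 ^ (n + 1)) := by
  unfold wStep
  rw [evalEval_sub, evalEval_pow, evalEval_mul, evalEval_pow, evalEval_C, evalEval_X]
  simp

open Polynomial in
theorem wStep_monic (a : ℂ) (n : ℕ) (p : ℂ[X][X]) (s : ℝ) (hp : p.Monic)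
    (hd : p.natDegree = 2 ^ (n + 1)) :
    (wStep a n p s).Monic ∧ (wStep a n p s).natDegree = 2 ^ (n + 2) := by
  have h1 : (p ^ 2).Monic := hp.pow 2
  have h2 : (p ^ 2).natDegree = 2 ^ (n + 2) := by
    rw [hp.natDegree_pow, hd]; ring
  have hlt : 2 ^ (n + 1) < 2 ^ (n + 2) := Nat.pow_lt_pow_right (by norm_num) (by omega)
  have h3 : ∀ c : ℂ[X], (C c * X ^ (2 ^ (n + 1)) : ℂ[X][X]).degree < (p ^ 2).degree := by
    intro c
    rw [degree_eq_natDegree h1.ne_zero, h2]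
    refine (degree_C_mul_X_pow_le _ _).trans_lt ?_
    exact_mod_cast hlt
  constructor
  · exact h1.sub_of_left (h3 _)
  · unfold wStep
    rw [natDegree_sub_eq_left_of_natDegree_lt, h2]
    rw [h2]; exact (natDegree_C_mul_X_pow_le _ _).trans_lt hlt

open Polynomial in
/-- Maximum principle on the variety `p = 0`. -/
theorem w_max (p P : ℂ[X][X]) (M : ℕ) (hM : M ≠ 0) (hp : p.Monic) (hd : p.natDegree = M)
    (h0 : ∀ w, p.evalEval 0 w = w ^ M) :
    ∃ z w : ℂ, ‖z‖ = 1 ∧ p.evalEval z w = 0 ∧ ‖P.evalEval 0 0‖ ≤ ‖P.evalEval z w‖ := by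
  set S : ℂ[X] := resultant p P M P.natDegree with hS
  have key : ∀ z : ℂ, S.eval z =
      ((p.map (evalRingHom z)).roots.map (P.map (evalRingHom z)).eval).prod := by
    intro z
    have h1 := resultant_eq_prod_eval (p.map (evalRingHom z)) (P.map (evalRingHom z)) P.natDegree
      natDegree_map_le (IsAlgClosed.splits _)
    rw [hp.natDegree_map, hd, resultant_map_map, (hp.map _).leadingCoeff, one_pow, one_mul] at h1
    rw [← h1]; rfl
  have hev : ∀ (q : ℂ[X][X]) (z w : ℂ), (q.map (evalRingHom z)).eval w = q.evalEval z w := by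
    intro q z w
    rw [← eval₂_evalRingHom, eval_map]
  have hp0 : p.map (evalRingHom 0) = X ^ M := by
    apply Polynomial.funext
    intro w
    rw [hev, h0]; simp
  have hS0 : S.eval 0 = (P.evalEval 0 0) ^ M := by
    rw [key, hp0, roots_X_pow]
    simp [Multiset.map_nsmul, Multiset.prod_nsmul, hev]
  obtain ⟨z, hz, hmax⟩ := Complex.exists_mem_frontier_isMaxOn_norm (f := fun z => S.eval z)
    (U := ball (0:ℂ) 1) isBounded_ball ⟨0, by simp⟩ S.differentiable.diffContOnCl
  have hz1 : ‖z‖ = 1 := by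
    rw [frontier_ball (0:ℂ) one_ne_zero] at hz; simpa using hz
  have hle : ‖S.eval 0‖ ≤ ‖S.eval z‖ := hmax (subset_closure (by simp))
  by_contra hcon
  push Not at hcon
  have hlt : ∀ w ∈ (p.map (evalRingHom z)).roots,
      ‖(P.map (evalRingHom z)).eval w‖ < ‖P.evalEval 0 0‖ := by
    intro w hw
    rw [hev]
    apply hcon z w hz1
    rw [← hev]
    exact (mem_roots (hp.map _).ne_zero).1 hw
  have hcard : Multiset.card (p.map (evalRingHom z)).roots = M := by
    rw [← (IsAlgClosed.splits _).natDegree_eq_card_roots, hp.natDegree_map, hd]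
  rw [hS0, key, norm_pow] at hle
  have : ∀ s : Multiset ℂ, ∀ (g : ℂ → ℂ) (c : ℝ), s ≠ 0 → (∀ w ∈ s, ‖g w‖ < c) →
      ‖(s.map g).prod‖ < c ^ (Multiset.card s) := by
    intro s g c
    induction s using Multiset.induction_on with
    | empty => intro h; exact absurd rfl h
    | cons x s ih =>
      intro _ h
      have hx := h x (by simp)
      have hc : 0 < c := (norm_nonneg _).trans_lt hx
      by_cases hs : s = 0
      · subst hs; simpa using hx
      · have := ih hs (fun w hw => h w (Multiset.mem_cons_of_mem hw))
        rw [Multiset.map_cons, Multiset.prod_cons, norm_mul, Multiset.card_cons, pow_succ, mul_comm]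
        exact mul_lt_mul'' this hx (norm_nonneg _) (norm_nonneg _)
  have h2 := this _ _ _ (by intro h; rw [h] at hcard; simp at hcard; omega) hlt
  rw [hcard] at h2
  linarith

theorem w_unit (u : ℂ) (hu : u ≠ 0) (him : (u + u⁻¹).im = 0) (hn : ‖u + u⁻¹‖ ≤ 1) : ‖u‖ = 1 := by
  have hN : 0 < Complex.normSq u := Complex.normSq_pos.2 hu
  have hre : |(u + u⁻¹).re| ≤ 1 := (Complex.abs_re_le_norm _).trans hn
  simp only [Complex.add_im, Complex.inv_im, Complex.add_re, Complex.inv_re] at him hre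
  have h1 : u.im * (Complex.normSq u - 1) = 0 := by
    field_simp at him; linarith
  rcases mul_eq_zero.1 h1 with h | h
  · exfalso
    have h2 : Complex.normSq u = u.re ^ 2 := by rw [Complex.normSq_apply, h]; ring
    rw [h2] at hre hN
    have hr : u.re ≠ 0 := by intro h; rw [h] at hN; simp at hN
    have h3 : u.re + u.re / u.re ^ 2 = u.re + u.re⁻¹ := by field_simp
    rw [h3] at hre
    have h4 := abs_le.1 hre
    have h5 : (u.re + u.re⁻¹) * u.re = u.re ^ 2 + 1 := by field_simp
    have h6 : (u.re + u.re⁻¹) ^ 2 ≤ 1 := by nlinarith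
    nlinarith [sq_nonneg (u.re - (u.re + u.re⁻¹) / 2)]
  · have : ‖u‖ ^ 2 = 1 := by rw [← Complex.normSq_eq_norm_sq]; linarith
    nlinarith [norm_nonneg u]

open Polynomial in
theorem w_next (a a' : ℂ) (n : ℕ) (p : ℂ[X][X]) (s : ℝ) (ha0 : 0 < ‖a‖) (ha1 : ‖a‖ < 1)
    (ha' : 0 < ‖a'‖) : ∃ s' : ℝ, 0 < s' ∧
      (0 < s → 4 * s' ^ 2 ≤ s ^ 4 * (1 - ‖a‖) ^ 2) ∧
      4 * s' ^ 2 < ‖a'‖ ^ (2 ^ (n + 2)) ∧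
      4 * s' ^ 2 ≤ (1 / ((n : ℝ) + 2)) ^ (2 ^ (n + 2)) ∧
      (0 < s → 4 * s ^ 2 < ‖p.evalEval a 0‖ → ∀ w, ‖p.evalEval a w‖ ≤ 4 * s ^ 2 →
        ((n : ℝ) + 1) * s' ≤ s ^ 4 * (‖a‖ * ‖w‖) ^ (2 ^ (n + 1)) * (1 - ‖a‖ ^ 2)) := by
  have hc : Continuous (fun x : ℝ => 4 * x ^ 2) := by fun_prop
  have small : ∀ c : ℝ, 0 < c → ∀ᶠ x : ℝ in nhdsWithin 0 (Set.Ioi 0), 4 * x ^ 2 < c := by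
    intro c hcpos
    apply nhdsWithin_le_nhds
    exact hc.continuousAt.eventually_lt continuousAt_const (by simpa using hcpos)
  have small2 : ∀ c : ℝ, 0 < c → ∀ᶠ x : ℝ in nhdsWithin 0 (Set.Ioi 0), ((n:ℝ) + 1) * x < c := by
    intro c hcpos
    apply nhdsWithin_le_nhds
    have hc2 : Continuous (fun x : ℝ => ((n:ℝ) + 1) * x) := by fun_prop
    exact hc2.continuousAt.eventually_lt continuousAt_const (by simpa using hcpos)
  have pos : ∀ᶠ x : ℝ in nhdsWithin 0 (Set.Ioi 0), 0 < x := eventually_mem_nhdsWithin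
  have e1 : ∀ᶠ x : ℝ in nhdsWithin 0 (Set.Ioi 0), (0 < s → 4 * x ^ 2 ≤ s ^ 4 * (1 - ‖a‖) ^ 2) := by
    by_cases hs : 0 < s
    · have h1 : 0 < 1 - ‖a‖ := by linarith
      filter_upwards [small (s ^ 4 * (1 - ‖a‖) ^ 2) (by positivity)] with x hx _ using hx.le
    · exact Filter.Eventually.of_forall fun x h => absurd h hs
  have e4 : ∀ᶠ x : ℝ in nhdsWithin 0 (Set.Ioi 0), (0 < s → 4 * s ^ 2 < ‖p.evalEval a 0‖ → ∀ w,
      ‖p.evalEval a w‖ ≤ 4 * s ^ 2 →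
        ((n : ℝ) + 1) * x ≤ s ^ 4 * (‖a‖ * ‖w‖) ^ (2 ^ (n + 1)) * (1 - ‖a‖ ^ 2)) := by
    by_cases hs : 0 < s ∧ 4 * s ^ 2 < ‖p.evalEval a 0‖
    · obtain ⟨hs, hp⟩ := hs
      have hcont : Continuous (fun w => ‖p.evalEval a w‖) := by
        have : (fun w => ‖p.evalEval a w‖) = fun w => ‖(p.map (evalRingHom a)).eval w‖ := by
          funext w; rw [← eval₂_evalRingHom, eval_map]
        rw [this]
        fun_prop
      have := (continuousAt_const.eventually_lt hcont.continuousAt hp)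
      obtain ⟨η, hη, hball⟩ := Metric.eventually_nhds_iff.1 this
      have h1 : 0 < 1 - ‖a‖ ^ 2 := by nlinarith
      filter_upwards [small2 (s ^ 4 * (‖a‖ * η) ^ (2 ^ (n + 1)) * (1 - ‖a‖ ^ 2)) (by positivity)]
        with x hx _ _ w hw
      have hwη : η ≤ ‖w‖ := by
        by_contra hlt
        push Not at hlt
        have := hball (y := w) (by simpa using hlt)
        linarith
      refine hx.le.trans ?_
      gcongr
    · exact Filter.Eventually.of_forall fun x h1 h2 => absurd ⟨h1, h2⟩ hs
  obtain ⟨x, h⟩ := (pos.and (e1.and ((small (‖a'‖ ^ (2 ^ (n + 2))) (by positivity)).and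
    ((small ((1 / ((n : ℝ) + 2)) ^ (2 ^ (n + 2))) (by positivity)).and e4)))).exists
  exact ⟨x, h.1, h.2.1, h.2.2.1, h.2.2.2.1.le, h.2.2.2.2⟩

open Polynomial in
/-- The data of the construction. -/
structure WData (a : ℕ → ℂ) where
  p : ℕ → ℂ[X][X]
  s : ℕ → ℝ
  ha0 : ∀ n, 0 < ‖a n‖
  ha1 : ∀ n, ‖a n‖ < 1
  hs : ∀ n, 0 < s n
  p0 : p 0 = X ^ 2 + C (X ^ 2)
  pS : ∀ n, p (n + 1) = wStep (a n) n (p n) (s n)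
  c1 : ∀ n, 4 * s (n + 1) ^ 2 ≤ s n ^ 4 * (1 - ‖a n‖) ^ 2
  c2 : ∀ n, 4 * s n ^ 2 < ‖a n‖ ^ (2 ^ (n + 1))
  c3 : ∀ n, 4 * s n ^ 2 ≤ (1 / ((n : ℝ) + 1)) ^ (2 ^ (n + 1))
  c4 : ∀ n w, ‖(p n).evalEval (a n) w‖ ≤ 4 * s n ^ 2 →
    ((n : ℝ) + 1) * s (n + 1) ≤ s n ^ 4 * (‖a n‖ * ‖w‖) ^ (2 ^ (n + 1)) * (1 - ‖a n‖ ^ 2)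

open Polynomial in
theorem w_eval0 (a : ℕ → ℂ) (p : ℕ → ℂ[X][X]) (s : ℕ → ℝ) (p0 : p 0 = X ^ 2 + C (X ^ 2))
    (pS : ∀ n, p (n + 1) = wStep (a n) n (p n) (s n)) (n : ℕ) :
    (∀ w, (p n).evalEval 0 w = w ^ (2 ^ (n + 1))) ∧
    (∀ z, (p n).evalEval z 0 = z ^ (2 ^ (n + 1))) ∧
    (p n).Monic ∧ (p n).natDegree = 2 ^ (n + 1) := by
  induction n with
  | zero =>
    rw [p0]
    refine ⟨fun w => ?_, fun z => ?_, ?_, ?_⟩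
    · rw [evalEval_add, evalEval_pow, evalEval_X, evalEval_C]; simp
    · rw [evalEval_add, evalEval_pow, evalEval_X, evalEval_C]; simp
    · exact monic_X_pow_add_C _ (by norm_num)
    · rw [natDegree_X_pow_add_C]; norm_num
  | succ n ih =>
    obtain ⟨h1, h2, h3, h4⟩ := ih
    have hne : 2 ^ (n + 1) - 1 ≠ 0 := by
      have : 2 ^ 1 ≤ 2 ^ (n + 1) := Nat.pow_le_pow_right (by norm_num) (by omega)
      omega
    rw [pS]
    refine ⟨fun w => ?_, fun z => ?_, wStep_monic _ _ _ _ h3 h4⟩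
    · rw [wStep_eval, h1, zero_pow hne]; ring
    · rw [wStep_eval, h2, zero_pow (by positivity)]; ring

open Polynomial in
theorem w_exists (a : ℕ → ℂ) (ha0 : ∀ n, 0 < ‖a n‖) (ha1 : ∀ n, ‖a n‖ < 1) :
    Nonempty (WData a) := by
  choose nx h1 h2 h3 h4 h5 using fun (n : ℕ) (q : ℂ[X][X] × ℝ) =>
    w_next (a n) (a (n + 1)) n q.1 q.2 (ha0 n) (ha1 n) (ha0 (n + 1))
  have small : ∀ c : ℝ, 0 < c → ∀ᶠ x : ℝ in nhdsWithin 0 (Set.Ioi 0), 4 * x ^ 2 < c := by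
    intro c hcpos
    apply nhdsWithin_le_nhds
    have hc : Continuous (fun x : ℝ => 4 * x ^ 2) := by fun_prop
    exact hc.continuousAt.eventually_lt continuousAt_const (by simpa using hcpos)
  have pos : ∀ᶠ x : ℝ in nhdsWithin 0 (Set.Ioi 0), 0 < x := eventually_mem_nhdsWithin
  obtain ⟨s0, hs0, hs1, hs2⟩ := (pos.and ((small (‖a 0‖ ^ 2) (by have := ha0 0; positivity)).and
    (small 1 one_pos))).exists
  let st : ℕ → ℂ[X][X] × ℝ := fun n => Nat.rec (X ^ 2 + C (X ^ 2), s0)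
    (fun n q => (wStep (a n) n q.1 q.2, nx n q)) n
  have st0 : st 0 = (X ^ 2 + C (X ^ 2), s0) := rfl
  have stS : ∀ n, st (n + 1) = (wStep (a n) n (st n).1 (st n).2, nx n (st n)) := fun n => rfl
  have hpos : ∀ n, 0 < (st n).2 := by
    intro n
    cases n with
    | zero => exact hs0
    | succ n => rw [stS]; exact h1 _ _
  have hev := w_eval0 a (fun n => (st n).1) (fun n => (st n).2) (by rw [st0])
    (fun n => by simp only [stS])
  have c2 : ∀ n, 4 * (st n).2 ^ 2 < ‖a n‖ ^ (2 ^ (n + 1)) := by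
    intro n
    cases n with
    | zero => simpa [st0] using hs1
    | succ n => rw [stS]; exact h3 _ _
  refine ⟨⟨fun n => (st n).1, fun n => (st n).2, ha0, ha1, hpos, by rw [st0],
    fun n => by simp only [stS], ?_, c2, ?_, ?_⟩⟩
  · intro n
    simp only [stS]
    exact h2 n (st n) (hpos n)
  · intro n
    cases n with
    | zero => simpa [st0] using hs2.le
    | succ n =>
      simp only [stS]
      have := h4 n (st n)
      push_cast
      have e : (n : ℝ) + 1 + 1 = n + 2 := by ring
      rw [e]; exact this
  · intro n w hw
    simp only [stS]
    refine h5 n (st n) (hpos n) ?_ w hw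
    rw [(hev n).2.1, norm_pow]
    exact c2 n

open Polynomial in
theorem w_real {a : ℕ → ℂ} (D : WData a) (n : ℕ) (z w : ℂ) (hz : ‖z‖ = 1)
    (h : (D.p n).evalEval z w = 0) :
    ‖w‖ = 1 ∧ ∀ m ≤ n, ‖(D.p m).evalEval z w‖ ≤ 4 * D.s m ^ 2 := by
  have hz0 : z ≠ 0 := by intro h; rw [h] at hz; simp at hz
  have hw0 : w ≠ 0 := by
    intro hw
    rw [hw, (w_eval0 a D.p D.s D.p0 D.pS n).2.1] at h
    exact hz0 (pow_eq_zero_iff (by positivity) |>.1 h)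
  set Q : ℕ → ℂ := fun m => (D.p m).evalEval z w / (z * w) ^ (2 ^ m) with hQ
  have hrel : ∀ m, Q (m + 1) = Q m ^ 2 - ((D.s m ^ 4 * ‖z - a m‖ ^ 2 : ℝ) : ℂ) := by
    intro m
    have hk : 2 ^ (m + 1) - 1 + 1 = 2 ^ (m + 1) := Nat.sub_add_cancel Nat.one_le_two_pow
    have e1 : z * z ^ (2 ^ (m + 1) - 1) = z ^ (2 ^ (m + 1)) := by rw [← pow_succ', hk]
    have e2 : (z - a m) * (1 - (starRingEnd ℂ) (a m) * z) = z * ((‖z - a m‖ ^ 2 : ℝ) : ℂ) := by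
      have h1 : z * (starRingEnd ℂ) z = 1 := by
        rw [Complex.mul_conj, Complex.normSq_eq_norm_sq, hz]; simp
      rw [← Complex.normSq_eq_norm_sq, ← Complex.mul_conj, map_sub]
      linear_combination (a m - z) * h1
    simp only [hQ]
    rw [D.pS, wStep_eval]
    have e3 : (z * w) ^ (2 ^ (m + 1)) = ((z * w) ^ (2 ^ m)) ^ 2 := by rw [← pow_mul, pow_succ]
    have hne : (z * w) ^ (2 ^ (m + 1)) ≠ 0 := by positivity
    rw [div_pow, ← e3, div_sub' hne]
    congr 1
    push_cast
    push_cast at e2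
    have e4 : (z * w) ^ (2 ^ (m + 1)) = z * z ^ (2 ^ (m + 1) - 1) * w ^ (2 ^ (m + 1)) := by
      rw [mul_pow, e1]
    rw [e4]
    linear_combination (-(D.s m : ℂ) ^ 4 * z ^ (2 ^ (m + 1) - 1) * w ^ (2 ^ (m + 1))) * e2
  have hclaim : ∀ k, k ≤ n → (Q (n - k)).im = 0 ∧ ‖Q (n - k)‖ ≤ 4 * D.s (n - k) ^ 2 := by
    intro k
    induction k with
    | zero =>
      intro _
      have : Q n = 0 := by simp only [hQ, h, zero_div]
      simp only [Nat.sub_zero, this]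
      refine ⟨rfl, ?_⟩
      rw [norm_zero]; positivity
    | succ k ih =>
      intro hk
      obtain ⟨i1, i2⟩ := ih (by omega)
      obtain ⟨m, hm⟩ : ∃ m, m = n - (k + 1) := ⟨_, rfl⟩
      have hm1 : n - k = m + 1 := by omega
      rw [← hm]
      rw [hm1] at i1 i2
      have hr := hrel m
      set S : ℝ := D.s m ^ 4 * ‖z - a m‖ ^ 2 with hS
      have h1 : ‖Q (m + 1)‖ ≤ S := by
        refine i2.trans ((D.c1 m).trans ?_)
        have : 1 - ‖a m‖ ≤ ‖z - a m‖ := by rw [← hz]; exact norm_sub_norm_le _ _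
        have := D.ha1 m
        have h0 : 0 ≤ 1 - ‖a m‖ := by linarith
        rw [hS]; gcongr
      have h2 : ‖z - a m‖ ≤ 2 := by
        refine (norm_sub_le _ _).trans ?_
        have := D.ha1 m
        linarith
      have h3 : S ≤ 4 * D.s m ^ 4 := by
        have : ‖z - a m‖ ^ 2 ≤ 2 ^ 2 := by gcongr
        have h4 : 0 ≤ D.s m ^ 4 := by positivity
        rw [hS]; nlinarith
      have hre : |(Q (m + 1)).re| ≤ S := (Complex.abs_re_le_norm _).trans h1
      have q1 := congrArg Complex.re hr
      have q2 := congrArg Complex.im hr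
      simp only [Complex.sub_re, Complex.sub_im, Complex.ofReal_re, Complex.ofReal_im, pow_two,
        Complex.mul_re, Complex.mul_im] at q1 q2
      rw [i1] at q2
      have hab := abs_le.1 hre
      have him : (Q m).im = 0 := by
        have : (Q m).re * (Q m).im = 0 := by linarith
        rcases mul_eq_zero.1 this with h | h
        · rw [h] at q1; nlinarith
        · exact h
      refine ⟨him, ?_⟩
      have hn : ‖Q m‖ ^ 2 = (Q m).re ^ 2 := by
        rw [← Complex.normSq_eq_norm_sq, Complex.normSq_apply, him]; ring
      rw [him] at q1
      apply le_of_sq_le_sq _ (by positivity)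
      rw [hn]
      have : 0 ≤ D.s m ^ 4 := by positivity
      nlinarith
  have hcl : ∀ m ≤ n, (Q m).im = 0 ∧ ‖Q m‖ ≤ 4 * D.s m ^ 2 := by
    intro m hm
    have := hclaim (n - m) (by omega)
    rwa [Nat.sub_sub_self hm] at this
  have hw1 : ‖w‖ = 1 := by
    obtain ⟨i1, i2⟩ := hcl 0 (by omega)
    have hQ0 : Q 0 = w / z + (w / z)⁻¹ := by
      simp only [hQ, D.p0]
      rw [evalEval_add, evalEval_pow, evalEval_X, evalEval_C]
      simp
      field_simp
    rw [hQ0] at i1 i2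
    have c3 := D.c3 0
    have := w_unit (w / z) (div_ne_zero hw0 hz0) i1 (i2.trans (c3.trans (by norm_num)))
    rwa [norm_div, hz, div_one] at this
  refine ⟨hw1, fun m hm => ?_⟩
  have := (hcl m hm).2
  simp only [hQ] at this
  rwa [norm_div, norm_pow, norm_mul, hz, hw1, one_mul, one_pow, div_one] at this

open Polynomial in
theorem w_diff (q : ℂ[X][X]) {g h : ℂ → ℂ} {U : Set ℂ} (hg : DifferentiableOn ℂ g U)
    (hh : DifferentiableOn ℂ h U) :
    DifferentiableOn ℂ (fun ζ => q.evalEval (g ζ) (h ζ)) U := by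
  induction q using Polynomial.induction_on' with
  | add p q hp hq =>
    simp only [evalEval_add]
    exact hp.add hq
  | monomial n c =>
    have : (fun ζ => (monomial n c : ℂ[X][X]).evalEval (g ζ) (h ζ)) =
        fun ζ => c.eval (g ζ) * h ζ ^ n := by
      funext ζ
      rw [← C_mul_X_pow_eq_monomial, evalEval_mul, evalEval_C, evalEval_pow, evalEval_X]
    rw [this]
    exact ((c.differentiable.comp_differentiableOn hg)).mul (hh.pow n)

open Polynomial in
theorem w_cap (q : ℂ[X]) (hq : q.Monic) (c : ℂ) (r B : ℝ) (hr : 0 < r)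
    (h : ∀ w ∈ sphere c r, ‖q.eval w‖ ≤ B) : r ^ q.natDegree ≤ B := by
  have h1 := Complex.norm_iteratedDeriv_le_of_forall_mem_sphere_norm_le q.natDegree hr
    q.differentiable.diffContOnCl h
  have h2 : iteratedDeriv q.natDegree (fun w => q.eval w) c = (q.natDegree.factorial : ℂ) := by
    have : ∀ n, iteratedDeriv n (fun w => q.eval w) = fun w => (derivative^[n] q).eval w := by
      intro n
      induction n with
      | zero => simp
      | succ n ih =>
        rw [iteratedDeriv_succ, ih]
        funext w
        rw [Function.iterate_succ_apply', Polynomial.deriv]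
    rw [this]
    have h3 : (derivative^[q.natDegree] q) = C (q.natDegree.factorial : ℂ) := by
      have hd : (derivative^[q.natDegree] q).natDegree = 0 := by
        have := natDegree_iterate_derivative q q.natDegree
        omega
      rw [eq_C_of_natDegree_eq_zero hd, coeff_iterate_derivative]
      simp [hq.coeff_natDegree, Nat.descFactorial_self]
    simp only [h3, eval_C]
  rw [h2, Complex.norm_natCast, mul_div_assoc] at h1
  have h4 : (0 : ℝ) < q.natDegree.factorial := by positivity
  have h5 : 1 ≤ B / r ^ q.natDegree := by
    by_contra hlt
    push Not at hlt
    nlinarith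
  rwa [le_div_iff₀ (by positivity), one_mul] at h5

open Polynomial in
theorem w_nodisc {a : ℕ → ℂ} (D : WData a)
    (hdense : ∀ U : Set ℂ, IsOpen U → U.Nonempty → U ⊆ closedBall 0 1 →
      ∀ N : ℕ, ∃ n ≥ N, a n ∈ U)
    (g h : ℂ → ℂ) (hg : DifferentiableOn ℂ g (ball 0 1)) (hh : DifferentiableOn ℂ h (ball 0 1))
    (hg1 : ∀ ζ ∈ ball (0:ℂ) 1, ‖g ζ‖ ≤ 1)
    (hX : ∀ ζ ∈ ball (0:ℂ) 1, ∀ n, ‖(D.p n).evalEval (g ζ) (h ζ)‖ ≤ 4 * D.s n ^ 2) :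
    (∃ c, ∀ ζ ∈ ball (0:ℂ) 1, g ζ = c) ∧ (∃ c, ∀ ζ ∈ ball (0:ℂ) 1, h ζ = c) := by
  have hconn : IsPreconnected (ball (0:ℂ) 1) := (convex_ball 0 1).isPreconnected
  have hle1 : ∀ n, 4 * D.s n ^ 2 ≤ 1 := by
    intro n
    refine (D.c3 n).trans (pow_le_one₀ (by positivity) ?_)
    rw [div_le_one (by positivity)]
    have : (0:ℝ) ≤ n := by positivity
    linarith
  have hgc : ∃ c, ∀ ζ ∈ ball (0:ℂ) 1, g ζ = c := by
    rcases (hg.analyticOnNhd isOpen_ball).is_constant_or_isOpen hconn with hc | hopen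
    · exact hc
    exfalso
    have hex : ∃ ζ ∈ ball (0:ℂ) 1, deriv g ζ ≠ 0 := by
      by_contra hcon
      push Not at hcon
      have h0 : (0:ℂ) ∈ ball (0:ℂ) 1 := by simp
      have hconst : ∀ ζ ∈ ball (0:ℂ) 1, g ζ = g 0 := fun ζ hζ =>
        isOpen_ball.is_const_of_deriv_eq_zero hconn hg hcon hζ h0
      have h1 := hopen _ subset_rfl isOpen_ball
      have h2 : g '' ball 0 1 = {g 0} := by
        ext y
        constructor
        · rintro ⟨ζ, hζ, rfl⟩; exact hconst ζ hζ
        · rintro rfl; exact ⟨0, h0, rfl⟩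
      rw [h2] at h1
      exact not_isOpen_singleton _ h1
    obtain ⟨ζs, hζs, hder⟩ := hex
    have hdc : ContinuousAt (fun ζ => ‖deriv g ζ‖) ζs :=
      ((hg.deriv isOpen_ball).differentiableAt (isOpen_ball.mem_nhds hζs)).continuousAt.norm
    set m : ℝ := ‖deriv g ζs‖ / 2 with hm
    have hm0 : 0 < m := by positivity
    have hev : ∀ᶠ ζ in nhds ζs, m < ‖deriv g ζ‖ :=
      continuousAt_const.eventually_lt hdc (by rw [hm]; exact half_lt_self (by positivity))
    obtain ⟨ρ, hρ, hball⟩ := Metric.eventually_nhds_iff_ball.1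
      (hev.and (isOpen_ball.mem_nhds hζs))
    set r := ρ / 3 with hr
    have hr0 : 0 < r := by positivity
    have hsub : ball ζs r ⊆ ball 0 1 := fun ζ hζ => (hball ζ (ball_subset_ball (by linarith) hζ)).2
    obtain ⟨N, hN⟩ := exists_nat_gt (8 / (r * m))
    obtain ⟨n, hn, ζ0, hζ0, hgζ⟩ := hdense (g '' ball ζs r) (hopen _ hsub isOpen_ball)
      ⟨g ζs, ζs, by simpa using hr0, rfl⟩
      (by rintro _ ⟨ζ, hζ, rfl⟩; simpa using hg1 ζ (hsub hζ)) N
    have hcl : closedBall ζ0 r ⊆ ball 0 1 := by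
      intro ζ hζ
      apply (hball ζ _).2
      rw [mem_ball] at hζ0 ⊢
      rw [mem_closedBall] at hζ
      have := dist_triangle ζ ζ0 ζs
      linarith
    have hm' : m < ‖deriv g ζ0‖ := (hball ζ0 (ball_subset_ball (by linarith) hζ0)).1
    have hζ1 : ζ0 ∈ ball (0:ℂ) 1 := hsub hζ0
    have hnh := isOpen_ball.mem_nhds hζ1
    have hFd := w_diff (D.p n) hg hh
    have hEd := w_diff (D.p (n + 1)) hg hh
    set F : ℂ → ℂ := fun ζ => (D.p n).evalEval (g ζ) (h ζ) with hF
    set E : ℂ → ℂ := fun ζ => (D.p (n + 1)).evalEval (g ζ) (h ζ) with hE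
    set R : ℂ → ℂ := fun ζ => (D.s n : ℂ) ^ 4 * g ζ ^ (2 ^ (n + 1) - 1) *
      (1 - (starRingEnd ℂ) (a n) * g ζ) * h ζ ^ (2 ^ (n + 1)) with hR
    have hgd := hg.differentiableAt hnh
    have hhd := hh.differentiableAt hnh
    have hRd : DifferentiableAt ℂ R ζ0 := by
      simp only [hR]; fun_prop
    have hEeq : E = fun ζ => F ζ ^ 2 - (g ζ - a n) * R ζ := by
      funext ζ
      simp only [hE, hF, hR, D.pS, wStep_eval]
      ring
    have cauchy : ∀ (f : ℂ → ℂ) (B : ℝ), DifferentiableOn ℂ f (ball 0 1) →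
        (∀ ζ ∈ ball (0:ℂ) 1, ‖f ζ‖ ≤ B) → ‖deriv f ζ0‖ ≤ B / r := by
      intro f B hf hB
      apply Complex.norm_deriv_le_of_forall_mem_sphere_norm_le hr0
      · exact (hf.mono hcl).diffContOnCl_ball subset_rfl
      · intro ζ hζ
        exact hB ζ (hcl (sphere_subset_closedBall hζ))
    have hF' := cauchy F 1 hFd (fun ζ hζ => (hX ζ hζ n).trans (hle1 n))
    have hE' := cauchy E _ hEd (fun ζ hζ => hX ζ hζ (n + 1))
    have hF2 := hFd.differentiableAt hnh
    have hderE : deriv E ζ0 = 2 * F ζ0 * deriv F ζ0 - deriv g ζ0 * R ζ0 := by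
      rw [hEeq]
      have h1 := (hF2.hasDerivAt.pow 2).sub ((hgd.hasDerivAt.sub_const (a n)).mul hRd.hasDerivAt)
      have h2 := h1.deriv
      rw [hgζ, sub_self, zero_mul, add_zero] at h2
      have h3 : deriv (F ^ 2 - (fun x => g x - a n) * R) ζ0 =
          2 * F ζ0 * deriv F ζ0 - deriv g ζ0 * R ζ0 := by simpa using h2
      exact h3
    have hE0 : E ζ0 = F ζ0 ^ 2 := by
      rw [hEeq]; simp [hgζ]
    have hs1 := D.hs (n + 1)
    have hFn : ‖F ζ0‖ ≤ 2 * D.s (n + 1) := by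
      have h1 := hX ζ0 hζ1 (n + 1)
      change ‖E ζ0‖ ≤ _ at h1
      rw [hE0, norm_pow] at h1
      apply le_of_sq_le_sq _ (by positivity)
      linarith
    have ha0 := D.ha0 n
    have ha1 := D.ha1 n
    have hRn : ((n : ℝ) + 1) * D.s (n + 1) ≤ ‖R ζ0‖ := by
      refine (D.c4 n (h ζ0) (by rw [← hgζ]; exact hX ζ0 hζ1 n)).trans ?_
      simp only [hR, hgζ]
      have hk : 2 ^ (n + 1) - 1 + 1 = 2 ^ (n + 1) := Nat.sub_add_cancel Nat.one_le_two_pow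
      have e1 : (1 - (starRingEnd ℂ) (a n) * a n) = ((1 - ‖a n‖ ^ 2 : ℝ) : ℂ) := by
        rw [mul_comm, Complex.mul_conj, Complex.normSq_eq_norm_sq]; push_cast; rfl
      have h1 : 0 ≤ 1 - ‖a n‖ ^ 2 := by nlinarith
      rw [e1]
      simp only [norm_mul, norm_pow, Complex.norm_real, Real.norm_eq_abs, abs_of_nonneg h1,
        abs_of_pos (D.hs n)]
      rw [mul_pow]
      have h2 : ‖a n‖ ^ (2 ^ (n + 1)) ≤ ‖a n‖ ^ (2 ^ (n + 1) - 1) :=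
        pow_le_pow_of_le_one ha0.le ha1.le (Nat.sub_le _ _)
      have h3 : D.s n ^ 4 * (‖a n‖ ^ (2 ^ (n + 1)) * ‖h ζ0‖ ^ (2 ^ (n + 1))) * (1 - ‖a n‖ ^ 2) ≤
          D.s n ^ 4 * (‖a n‖ ^ (2 ^ (n + 1) - 1) * ‖h ζ0‖ ^ (2 ^ (n + 1))) * (1 - ‖a n‖ ^ 2) := by
        gcongr
      refine h3.trans (le_of_eq ?_)
      ring
    have hfin : ‖deriv g ζ0‖ * ‖R ζ0‖ ≤ 8 * D.s (n + 1) / r := by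
      have e : deriv g ζ0 * R ζ0 = 2 * F ζ0 * deriv F ζ0 - deriv E ζ0 := by rw [hderE]; ring
      rw [← norm_mul, e]
      refine (norm_sub_le _ _).trans ?_
      rw [norm_mul, norm_mul]
      have h1 : ‖(2:ℂ)‖ * ‖F ζ0‖ * ‖deriv F ζ0‖ ≤ 2 * (2 * D.s (n + 1)) * (1 / r) := by
        rw [Complex.norm_two]; gcongr
      have h2 : 4 * D.s (n + 1) ^ 2 / r ≤ 4 * D.s (n + 1) / r := by
        have := hle1 (n + 1)
        gcongr
        nlinarith
      have h3 : 2 * (2 * D.s (n + 1)) * (1 / r) + 4 * D.s (n + 1) / r = 8 * D.s (n + 1) / r := by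
        ring
      linarith
    have h1 : m * (((n : ℝ) + 1) * D.s (n + 1)) ≤ 8 * D.s (n + 1) / r :=
      le_trans (by gcongr) hfin
    rw [le_div_iff₀ hr0] at h1
    have h2 : (8 : ℝ) < (N : ℝ) * (r * m) := (div_lt_iff₀ (by positivity)).1 hN
    have h3 : (N : ℝ) ≤ n := by exact_mod_cast hn
    have h4 : (8 : ℝ) < ((n : ℝ) + 1) * (r * m) := by
      refine h2.trans_le ?_
      gcongr
      linarith
    nlinarith
  refine ⟨hgc, ?_⟩
  obtain ⟨z0, hz0⟩ := hgc
  rcases (hh.analyticOnNhd isOpen_ball).is_constant_or_isOpen hconn with hc | hopen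
  · exact hc
  exfalso
  have hU := hopen _ subset_rfl isOpen_ball
  obtain ⟨ρ, hρ, hb⟩ := Metric.isOpen_iff.1 hU (h 0) ⟨0, by simp, rfl⟩
  obtain ⟨n, hn⟩ := exists_nat_gt (1 / (ρ / 2))
  obtain ⟨-, -, hmon, hdeg⟩ := w_eval0 a D.p D.s D.p0 D.pS n
  have h1 := w_cap ((D.p n).map (evalRingHom z0)) (hmon.map _) (h 0) (ρ / 2) (4 * D.s n ^ 2)
    (by positivity) (by
      intro w hw
      obtain ⟨ζ, hζ, rfl⟩ := hb (sphere_subset_closedBall.trans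
        (closedBall_subset_ball (by linarith)) hw)
      have := hX ζ hζ n
      rwa [hz0 ζ hζ, ← eval₂_evalRingHom, ← eval_map] at this)
  rw [hmon.natDegree_map, hdeg] at h1
  have h2 := h1.trans (D.c3 n)
  have h3 : ρ / 2 ≤ 1 / ((n : ℝ) + 1) := le_of_pow_le_pow_left₀ (by positivity) (by positivity) h2
  rw [div_lt_iff₀ (by positivity)] at hn
  rw [le_div_iff₀ (by positivity)] at h3
  nlinarith

/-- Working form of membership in the hull. -/
def Hl {m : ℕ} (K : Set (Fin m → ℂ)) (x : Fin m → ℂ) : Prop :=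
  ∀ p : MvPolynomial (Fin m) ℂ, ∃ y ∈ K, ‖MvPolynomial.eval x p‖ ≤ ‖MvPolynomial.eval y p‖

theorem hull_iff {m : ℕ} {K : Set (Fin m → ℂ)} (hK : IsCompact K) (hne : K.Nonempty)
    (x : Fin m → ℂ) : x ∈ polyHull K ↔ Hl K x := by
  have hc : ∀ p : MvPolynomial (Fin m) ℂ, Continuous fun y => ‖MvPolynomial.eval y p‖ :=
    fun p => (MvPolynomial.continuous_eval p).norm
  constructor
  · intro h p
    obtain ⟨y, hy, hmax⟩ := hK.exists_isMaxOn hne (hc p).continuousOn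
    refine ⟨y, hy, (h p).trans (csSup_le (hne.image _) ?_)⟩
    rintro _ ⟨w, hw, rfl⟩
    exact hmax hw
  · intro h p
    obtain ⟨y, hy, hle⟩ := h p
    exact hle.trans (le_csSup (hK.image (hc p)).bddAbove ⟨y, hy, rfl⟩)

theorem Hl_re {m : ℕ} {K : Set (Fin m → ℂ)} (hK : IsCompact K) {x : Fin m → ℂ} (h : Hl K x)
    (p : MvPolynomial (Fin m) ℂ) (c : ℝ) (hc : ∀ y ∈ K, (MvPolynomial.eval y p).re ≤ c) :
    (MvPolynomial.eval x p).re ≤ c := by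
  obtain ⟨B, hB⟩ := hK.exists_bound_of_continuousOn
    (f := fun y => MvPolynomial.eval y p) (MvPolynomial.continuous_eval p).continuousOn
  by_contra hlt
  push Not at hlt
  set d := (MvPolynomial.eval x p).re - c with hd
  have hd0 : 0 < d := by linarith
  obtain ⟨n, hn⟩ := exists_nat_gt (|c| + |B| + B ^ 2 / d)
  obtain ⟨y, hy, hle⟩ := h (MvPolynomial.C (n : ℂ) + p)
  simp only [map_add, MvPolynomial.eval_C] at hle
  have h1 : ‖(n : ℂ) + MvPolynomial.eval x p‖ ^ 2 ≤ ‖(n : ℂ) + MvPolynomial.eval y p‖ ^ 2 := by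
    gcongr
  rw [← Complex.normSq_eq_norm_sq, ← Complex.normSq_eq_norm_sq, Complex.normSq_apply,
    Complex.normSq_apply] at h1
  simp only [Complex.add_re, Complex.add_im, Complex.natCast_re, Complex.natCast_im,
    zero_add] at h1
  have h2 := hB y hy
  have h3 := (Complex.abs_re_le_norm (MvPolynomial.eval y p)).trans h2
  have h4 := (Complex.abs_im_le_norm (MvPolynomial.eval y p)).trans h2
  have h5 := hc y hy
  set u := (MvPolynomial.eval y p).re
  set v := (MvPolynomial.eval y p).im
  have h6 : v ^ 2 ≤ B ^ 2 := by
    rw [← sq_abs v]; gcongr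
  have h7 : 0 ≤ B ^ 2 / d := by positivity
  have h8 := neg_abs_le c
  have h9 := le_abs_self B
  have h10 := abs_le.1 h3
  have h11 : B ^ 2 / d * d = B ^ 2 := by field_simp
  have h12 := abs_nonneg c
  have h13 := abs_nonneg B
  have hx : (MvPolynomial.eval x p).re = c + d := by rw [hd]; ring
  rw [hx] at h1
  have k1 : (n + u) * (n + u) ≤ (n + c) * (n + c) := by
    have h14 : 0 ≤ n + u := by linarith
    have h15 : (0:ℝ) ≤ n + c := by linarith
    gcongr
  have k2 : B ^ 2 < (n + c) * d := by
    rw [← h11]; gcongr; linarith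
  nlinarith [mul_self_nonneg (MvPolynomial.eval x p).im]

theorem Hl_fiber {K : Set (Fin 3 → ℂ)} (hK : IsCompact K) (hreal : ∀ y ∈ K, (y 2).im = 0)
    {x : Fin 3 → ℂ} (h : Hl K x) : (x 2).im = 0 ∧ Hl (K ∩ {y | y 2 = x 2}) x := by
  have him : (x 2).im = 0 := by
    have h1 := Hl_re hK h (MvPolynomial.C Complex.I * MvPolynomial.X 2) 0
      (fun y hy => by simp [hreal y hy])
    have h2 := Hl_re hK h (MvPolynomial.C (-Complex.I) * MvPolynomial.X 2) 0
      (fun y hy => by simp [hreal y hy])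
    simp at h1 h2
    linarith
  refine ⟨him, ?_⟩
  have hmain : ∀ p : MvPolynomial (Fin 3) ℂ, MvPolynomial.eval x p ≠ 0 →
      ∃ y ∈ K ∩ {y | y 2 = x 2}, ‖MvPolynomial.eval x p‖ ≤ ‖MvPolynomial.eval y p‖ := by
    intro p hp
    have hcp := (MvPolynomial.continuous_eval p).norm
    set S := K ∩ {y | ‖MvPolynomial.eval x p‖ ≤ ‖MvPolynomial.eval y p‖} with hS
    have hSc : IsCompact S := hK.inter_right (isClosed_le continuous_const hcp)
    have hSne : S.Nonempty := by
      obtain ⟨y, hy, hle⟩ := h p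
      exact ⟨y, hy, hle⟩
    have hcd : Continuous fun y : Fin 3 → ℂ => ‖y 2 - x 2‖ := by fun_prop
    obtain ⟨ys, hys, hmin⟩ := hSc.exists_isMinOn hSne hcd.continuousOn
    by_cases h0 : ys 2 = x 2
    · exact ⟨ys, ⟨hys.1, h0⟩, hys.2⟩
    exfalso
    have hm0 : 0 < ‖ys 2 - x 2‖ := norm_pos_iff.2 (sub_ne_zero.2 h0)
    set m := ‖ys 2 - x 2‖ with hm
    obtain ⟨B, hB⟩ := hK.exists_bound_of_continuousOn
      (f := fun y => MvPolynomial.eval y p) (MvPolynomial.continuous_eval p).continuousOn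
    obtain ⟨M, hM⟩ := hK.exists_bound_of_continuousOn
      (f := fun y : Fin 3 → ℂ => y 2 - x 2) (by fun_prop)
    have hM0 : 0 < M := hm0.trans_le (hM ys hys.1)
    have hmM : m ≤ M := hM ys hys.1
    set ρ := 1 - m ^ 2 / M ^ 2 with hρ
    have hρ0 : 0 ≤ ρ := by
      rw [hρ, sub_nonneg, div_le_one (by positivity)]; gcongr
    have hρ1 : ρ < 1 := by
      have : 0 < m ^ 2 / M ^ 2 := by positivity
      linarith
    have key : ∀ N : ℕ, ‖MvPolynomial.eval x p‖ ≤ B * ρ ^ N := by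
      intro N
      obtain ⟨y, hy, hle⟩ := h (p * (1 - MvPolynomial.C ((1 / M ^ 2 : ℝ) : ℂ) *
        (MvPolynomial.X 2 - MvPolynomial.C (x 2)) ^ 2) ^ N)
      simp only [map_mul, map_pow, map_sub, map_one, MvPolynomial.eval_C, MvPolynomial.eval_X,
        sub_self, norm_mul, norm_pow] at hle
      have hd : y 2 - x 2 = (((y 2).re - (x 2).re : ℝ) : ℂ) := by
        apply Complex.ext <;> simp [hreal y hy, him]
      set d := (y 2).re - (x 2).re with hdd
      have hdn : ‖y 2 - x 2‖ = |d| := by rw [hd, Complex.norm_real, Real.norm_eq_abs]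
      have hdM : d ^ 2 ≤ M ^ 2 := by
        rw [← sq_abs d, ← hdn]
        have := hM y hy
        gcongr
      have hfac : ‖(1 : ℂ) - ((1 / M ^ 2 : ℝ) : ℂ) * (y 2 - x 2) ^ 2‖ = 1 - d ^ 2 / M ^ 2 := by
        have e : (1 : ℂ) - ((1 / M ^ 2 : ℝ) : ℂ) * (y 2 - x 2) ^ 2 =
            ((1 - d ^ 2 / M ^ 2 : ℝ) : ℂ) := by
          rw [hd]; push_cast; ring
        rw [e, Complex.norm_real, Real.norm_eq_abs, abs_of_nonneg]
        rw [sub_nonneg, div_le_one (by positivity)]; exact hdM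
      rw [hfac] at hle
      have hf0 : 0 ≤ 1 - d ^ 2 / M ^ 2 := by rw [← hfac]; positivity
      have hf1 : 1 - d ^ 2 / M ^ 2 ≤ 1 := by
        have : 0 ≤ d ^ 2 / M ^ 2 := by positivity
        linarith
      have e0 : ‖(1 : ℂ) - ((1 / M ^ 2 : ℝ) : ℂ) * 0 ^ 2‖ = 1 := by simp
      rw [e0, one_pow, mul_one] at hle
      have hyS : y ∈ S := by
        refine ⟨hy, hle.trans ?_⟩
        exact mul_le_of_le_one_right (norm_nonneg _) (pow_le_one₀ hf0 hf1)
      have hmd : m ^ 2 ≤ d ^ 2 := by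
        have h1 : m ≤ ‖y 2 - x 2‖ := hmin hyS
        rw [hdn] at h1
        rw [← sq_abs d]; gcongr
      have hfρ : 1 - d ^ 2 / M ^ 2 ≤ ρ := by
        rw [hρ]; gcongr
      refine hle.trans ?_
      have hBy := hB y hy
      have hB0 : 0 ≤ B := (norm_nonneg _).trans hBy
      gcongr
    have hlim : Filter.Tendsto (fun N : ℕ => B * ρ ^ N) Filter.atTop (nhds (B * 0)) :=
      (tendsto_pow_atTop_nhds_zero_of_lt_one hρ0 hρ1).const_mul B
    have := ge_of_tendsto' hlim key
    rw [mul_zero] at this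
    exact hp (norm_le_zero_iff.1 this)
  intro p
  by_cases hp : MvPolynomial.eval x p = 0
  · obtain ⟨y, hy, -⟩ := hmain 1 (by simp)
    exact ⟨y, hy, by rw [hp, norm_zero]; positivity⟩
  · exact hmain p hp

theorem re_inv_formula (v : ℂ) (hv : 1 - v ≠ 0) :
    ((1 - v)⁻¹).re = 1 / 2 + (1 - ‖v‖ ^ 2) / (2 * ‖1 - v‖ ^ 2) := by
  have hN : 0 < Complex.normSq (1 - v) := Complex.normSq_pos.2 hv
  rw [Complex.inv_re, ← Complex.normSq_eq_norm_sq, ← Complex.normSq_eq_norm_sq]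
  have e : Complex.normSq (1 - v) = 1 - 2 * v.re + Complex.normSq v := by
    simp [Complex.normSq_apply]; ring
  field_simp
  rw [e]; simp; ring

theorem Hl_arc {K : Set (Fin 3 → ℂ)} (hK : IsCompact K)
    (h1 : ∀ y ∈ K, ‖y 0 * y 1‖ = 1) (h2 : ∀ y ∈ K, y 0 * y 1 ≠ 1)
    {x : Fin 3 → ℂ} (h : Hl K x) : 1 ≤ ‖x 0 * x 1‖ := by
  by_contra hlt
  push Not at hlt
  have hne : K.Nonempty := by
    obtain ⟨y, hy, -⟩ := h 1
    exact ⟨y, hy⟩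
  obtain ⟨ys, hys, hmin⟩ := hK.exists_isMinOn (f := fun y : Fin 3 → ℂ => ‖1 - y 0 * y 1‖) hne
    (by fun_prop)
  set d := ‖1 - ys 0 * ys 1‖ with hd
  have hd0 : 0 < d := norm_pos_iff.2 (sub_ne_zero.2 (h2 ys hys).symm)
  set e := (1 - ‖x 0 * x 1‖ ^ 2) / 8 with he
  have he0 : 0 < e := by
    have : ‖x 0 * x 1‖ ^ 2 < 1 := by
      rw [sq_lt_one_iff_abs_lt_one, abs_norm]; exact hlt
    rw [he]; linarith
  have hr : ∃ r : ℝ, 0 < r ∧ r < 1 ∧ 1 - r < d / 2 ∧ 2 * (1 - r ^ 2) / d ^ 2 < e / 2 := by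
    have p1 : ∀ᶠ r : ℝ in nhdsWithin 1 (Set.Iio 1), r < 1 := eventually_mem_nhdsWithin
    have p2 : ∀ᶠ r : ℝ in nhdsWithin 1 (Set.Iio 1), 0 < r :=
      nhdsWithin_le_nhds (eventually_gt_nhds one_pos)
    have p3 : ∀ᶠ r : ℝ in nhdsWithin 1 (Set.Iio 1), 1 - r < d / 2 := by
      apply nhdsWithin_le_nhds
      have hc : Continuous fun r : ℝ => 1 - r := by fun_prop
      exact hc.continuousAt.eventually_lt continuousAt_const (by simpa using hd0)
    have p4 : ∀ᶠ r : ℝ in nhdsWithin 1 (Set.Iio 1), 2 * (1 - r ^ 2) / d ^ 2 < e / 2 := by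
      apply nhdsWithin_le_nhds
      have hc : Continuous fun r : ℝ => 2 * (1 - r ^ 2) / d ^ 2 := by fun_prop
      exact hc.continuousAt.eventually_lt continuousAt_const (by simpa using he0)
    obtain ⟨r, q⟩ := (p2.and (p1.and (p3.and p4))).exists
    exact ⟨r, q⟩
  obtain ⟨r, hr0, hr1, hrd, hre⟩ := hr
  obtain ⟨N, hN⟩ : ∃ N : ℕ, 2 * (r ^ N / (1 - r)) < e / 2 := by
    have hlim : Filter.Tendsto (fun N : ℕ => 2 * (r ^ N / (1 - r))) Filter.atTop
        (nhds (2 * (0 / (1 - r)))) :=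
      ((tendsto_pow_atTop_nhds_zero_of_lt_one hr0.le hr1).div_const _).const_mul 2
    exact (hlim.eventually (gt_mem_nhds (by simpa using he0))).exists
  set P : MvPolynomial (Fin 3) ℂ := ∑ k ∈ Finset.range N,
    (MvPolynomial.C (r : ℂ) * (MvPolynomial.X 0 * MvPolynomial.X 1)) ^ k with hP
  have hev : ∀ y : Fin 3 → ℂ, ‖y 0 * y 1‖ ≤ 1 →
      |(MvPolynomial.eval y P).re - ((1 - (r : ℂ) * (y 0 * y 1))⁻¹).re| ≤ r ^ N / (1 - r) ∧
      1 - (r : ℂ) * (y 0 * y 1) ≠ 0 := by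
    intro y hy
    set v := (r : ℂ) * (y 0 * y 1) with hv
    have hvn : ‖v‖ ≤ r := by
      rw [hv, norm_mul, Complex.norm_real, Real.norm_eq_abs, abs_of_pos hr0]
      exact mul_le_of_le_one_right hr0.le hy
    have hge : 1 - r ≤ ‖1 - v‖ := by
      have := norm_sub_norm_le (1:ℂ) v
      rw [norm_one] at this; linarith
    have hv1 : 1 - v ≠ 0 := by
      rw [← norm_pos_iff]; linarith
    refine ⟨?_, hv1⟩
    have e1 : MvPolynomial.eval y P = ∑ k ∈ Finset.range N, v ^ k := by
      simp [hP, hv]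
    have e2 : MvPolynomial.eval y P - (1 - v)⁻¹ = - (v ^ N / (1 - v)) := by
      have := mul_neg_geom_sum v N
      rw [e1]
      field_simp
      rw [mul_comm] at this
      linear_combination this
    rw [← Complex.sub_re, e2]
    refine (Complex.abs_re_le_norm _).trans ?_
    rw [norm_neg, norm_div, norm_pow]
    have : 0 < 1 - r := by linarith
    gcongr
  have hK' : ∀ y ∈ K, (MvPolynomial.eval y P).re ≤
      1 / 2 + 2 * (1 - r ^ 2) / d ^ 2 + r ^ N / (1 - r) := by
    intro y hy
    obtain ⟨k1, k2⟩ := hev y (h1 y hy).le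
    have k3 := re_inv_formula _ k2
    have hn : ‖(r : ℂ) * (y 0 * y 1)‖ = r := by
      rw [norm_mul, h1 y hy, Complex.norm_real, Real.norm_eq_abs, abs_of_pos hr0, mul_one]
    rw [hn] at k3
    have hge : d / 2 ≤ ‖1 - (r : ℂ) * (y 0 * y 1)‖ := by
      have l1 : d ≤ ‖1 - y 0 * y 1‖ := hmin hy
      have l2 : 1 - y 0 * y 1 = (1 - (r : ℂ) * (y 0 * y 1)) - ((1 - r : ℝ) : ℂ) * (y 0 * y 1) := by
        push_cast; ring
      have l3 : ‖((1 - r : ℝ) : ℂ) * (y 0 * y 1)‖ = 1 - r := by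
        rw [norm_mul, h1 y hy, Complex.norm_real, Real.norm_eq_abs, abs_of_pos (by linarith),
          mul_one]
      have l4 := norm_sub_le (1 - (r : ℂ) * (y 0 * y 1)) (((1 - r : ℝ) : ℂ) * (y 0 * y 1))
      rw [← l2, l3] at l4
      linarith
    have k4 : (1 - r ^ 2) / (2 * ‖1 - (r : ℂ) * (y 0 * y 1)‖ ^ 2) ≤
        (1 - r ^ 2) / (2 * (d / 2) ^ 2) := by
      have : 0 ≤ 1 - r ^ 2 := by nlinarith
      gcongr
    have k5 : (1 - r ^ 2) / (2 * (d / 2) ^ 2) = 2 * (1 - r ^ 2) / d ^ 2 := by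
      field_simp
    have := (abs_le.1 k1).2
    linarith
  have hx := Hl_re hK h P _ hK'
  obtain ⟨k1, k2⟩ := hev x hlt.le
  have k3 := re_inv_formula _ k2
  have hn : ‖(r : ℂ) * (x 0 * x 1)‖ ≤ ‖x 0 * x 1‖ := by
    rw [norm_mul, Complex.norm_real, Real.norm_eq_abs, abs_of_pos hr0]
    exact mul_le_of_le_one_left (norm_nonneg _) hr1.le
  have hle2 : ‖1 - (r : ℂ) * (x 0 * x 1)‖ ≤ 2 := by
    refine (norm_sub_le _ _).trans ?_
    rw [norm_one]; linarith
  have hpos : 0 < ‖1 - (r : ℂ) * (x 0 * x 1)‖ := norm_pos_iff.2 k2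
  have k4 : e ≤ (1 - ‖(r : ℂ) * (x 0 * x 1)‖ ^ 2) / (2 * ‖1 - (r : ℂ) * (x 0 * x 1)‖ ^ 2) := by
    rw [he]
    have q1 : ‖(r : ℂ) * (x 0 * x 1)‖ ^ 2 ≤ ‖x 0 * x 1‖ ^ 2 := by gcongr
    have q2 : 2 * ‖1 - (r : ℂ) * (x 0 * x 1)‖ ^ 2 ≤ 8 := by nlinarith
    have q3 : 0 ≤ 1 - ‖x 0 * x 1‖ ^ 2 := by rw [he] at he0; linarith
    exact div_le_div₀ (by linarith) (by linarith) (by positivity) q2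
  have := (abs_le.1 k1).1
  linarith

theorem Hl_zero {K : Set (Fin 3 → ℂ)} (P : MvPolynomial (Fin 3) ℂ) (δ : ℝ) (hδ : 0 < δ)
    (h1 : ∀ y ∈ K, ‖y 0 * y 1‖ ≤ 1)
    (h2 : ∀ y ∈ K, y 0 * y 1 = 1 ∨ ‖MvPolynomial.eval y P‖ ≤ δ)
    {x : Fin 3 → ℂ} (h : Hl K x) : x 0 * x 1 = 1 ∨ ‖MvPolynomial.eval x P‖ ≤ δ := by
  by_contra hcon
  push Not at hcon
  obtain ⟨c1, c2⟩ := hcon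
  set A := ‖MvPolynomial.eval x P‖ with hA
  set b := ‖1 - x 0 * x 1‖ with hb
  have hb0 : 0 < b := norm_pos_iff.2 (sub_ne_zero.2 (Ne.symm c1))
  have hA0 : 0 < A := hδ.trans c2
  have key : ∀ N : ℕ, (A / δ) ^ N ≤ 2 / b := by
    intro N
    obtain ⟨y, hy, hle⟩ := h (P ^ N * (1 - MvPolynomial.X 0 * MvPolynomial.X 1))
    simp only [map_mul, map_pow, map_sub, map_one, MvPolynomial.eval_X, norm_mul (_ ^ _),
      norm_pow] at hle
    rcases h2 y hy with hy1 | hy2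
    · rw [hy1, sub_self, norm_zero, mul_zero] at hle
      have : 0 < A ^ N * b := by positivity
      exact absurd hle (not_le.2 this)
    · rw [div_pow, div_le_div_iff₀ (by positivity) hb0]
      refine hle.trans ?_
      rw [mul_comm 2]
      have : ‖1 - y 0 * y 1‖ ≤ 2 := by
        refine (norm_sub_le _ _).trans ?_
        rw [norm_one]
        have := h1 y hy
        linarith
      gcongr
  obtain ⟨N, hN⟩ := pow_unbounded_of_one_lt (2 / b) ((one_lt_div hδ).2 c2)
  exact absurd (key N) (not_le.2 hN)

theorem seq_exists : ∃ a : ℕ → ℂ, (∀ n, 0 < ‖a n‖) ∧ (∀ n, ‖a n‖ < 1) ∧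
    ∀ U : Set ℂ, IsOpen U → U.Nonempty → U ⊆ closedBall 0 1 → ∀ N : ℕ, ∃ n ≥ N, a n ∈ U := by
  classical
  set e := TopologicalSpace.denseSeq ℂ with he
  set b : ℕ → ℂ := fun k => if 0 < ‖e k‖ ∧ ‖e k‖ < 1 then e k else 1 / 2 with hb
  have hb0 : ∀ k, 0 < ‖b k‖ ∧ ‖b k‖ < 1 := by
    intro k
    simp only [hb]
    split_ifs with h
    · exact h
    · norm_num
  refine ⟨fun n => b (Nat.unpair n).1, fun n => (hb0 _).1, fun n => (hb0 _).2, ?_⟩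
  intro U hU hne hsub N
  have hU1 : U ⊆ ball 0 1 := by
    have := interior_maximal hsub hU
    rwa [interior_closedBall _ one_ne_zero] at this
  have hV : IsOpen (U \ {0}) := hU.sdiff isClosed_singleton
  have hVne : (U \ {0}).Nonempty := by
    by_contra hcon
    rw [Set.not_nonempty_iff_eq_empty, Set.diff_eq_empty] at hcon
    have : U = {0} := (Set.Nonempty.subset_singleton_iff hne).1 hcon
    rw [this] at hU
    exact not_isOpen_singleton (0:ℂ) hU
  obtain ⟨k, hk⟩ := (TopologicalSpace.denseRange_denseSeq ℂ).exists_mem_open hV hVne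
  refine ⟨Nat.pair k N, Nat.right_le_pair k N, ?_⟩
  have h1 : 0 < ‖e k‖ := norm_pos_iff.2 (fun h => hk.2 h)
  have h2 : ‖e k‖ < 1 := by simpa using hU1 hk.1
  have h3 : b k = e k := by simp only [hb]; rw [if_pos ⟨h1, h2⟩]
  simp only [Nat.unpair_pair]
  rw [h3]; exact hk.1

open Polynomial in
theorem toMv (q : ℂ[X][X]) : ∃ Q : MvPolynomial (Fin 3) ℂ,
    ∀ x : Fin 3 → ℂ, MvPolynomial.eval x Q = q.evalEval (x 0) (x 1) := by
  have hC : ∀ r : ℂ[X], ∃ Q : MvPolynomial (Fin 3) ℂ,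
      ∀ x : Fin 3 → ℂ, MvPolynomial.eval x Q = r.eval (x 0) := by
    intro r
    induction r using Polynomial.induction_on' with
    | add p q hp hq =>
      obtain ⟨P, hP⟩ := hp
      obtain ⟨Q, hQ⟩ := hq
      exact ⟨P + Q, fun x => by rw [map_add, hP, hQ, eval_add]⟩
    | monomial n c =>
      exact ⟨MvPolynomial.C c * MvPolynomial.X 0 ^ n, fun x => by simp⟩
  induction q using Polynomial.induction_on' with
  | add p q hp hq =>
    obtain ⟨P, hP⟩ := hp
    obtain ⟨Q, hQ⟩ := hq
    exact ⟨P + Q, fun x => by rw [map_add, hP, hQ, evalEval_add]⟩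
  | monomial n c =>
    obtain ⟨Q, hQ⟩ := hC c
    exact ⟨Q * MvPolynomial.X 1 ^ n, fun x => by simp [hQ, evalEval]⟩

open Polynomial in
theorem ofMv (p : MvPolynomial (Fin 3) ℂ) : ∃ P : ℂ[X][X],
    ∀ z w : ℂ, P.evalEval z w = MvPolynomial.eval ![z, w, 0] p := by
  induction p using MvPolynomial.induction_on with
  | C c => exact ⟨C (C c), fun z w => by simp [evalEval]⟩
  | add p q hp hq =>
    obtain ⟨P, hP⟩ := hp
    obtain ⟨Q, hQ⟩ := hq
    exact ⟨P + Q, fun z w => by rw [map_add, evalEval_add, hP, hQ]⟩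
  | mul_X p i hp =>
    obtain ⟨P, hP⟩ := hp
    fin_cases i
    · exact ⟨P * C X, fun z w => by rw [map_mul, evalEval_mul, hP]; simp [evalEval]⟩
    · exact ⟨P * X, fun z w => by rw [map_mul, evalEval_mul, hP]; simp [evalEval]⟩
    · exact ⟨0, fun z w => by rw [map_mul]; simp [evalEval]⟩

theorem const_of_max (g : ℂ → ℂ) (hg : DifferentiableOn ℂ g (ball 0 1))
    (h1 : ∀ z ∈ ball (0:ℂ) 1, ‖g z‖ ≤ 1) (z0 : ℂ) (hz0 : z0 ∈ ball (0:ℂ) 1) (h : 1 ≤ ‖g z0‖) :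
    ∀ z ∈ ball (0:ℂ) 1, g z = g z0 := by
  intro z hz
  exact Complex.eqOn_of_isPreconnected_of_isMaxOn_norm (convex_ball (0:ℂ) 1).isPreconnected
    isOpen_ball hg hz0 (fun w hw => (h1 w hw).trans h) hz

theorem const_of_real (g : ℂ → ℂ) (hg : DifferentiableOn ℂ g (ball 0 1))
    (h1 : ∀ z ∈ ball (0:ℂ) 1, (g z).im = 0) :
    ∀ z ∈ ball (0:ℂ) 1, g z = g 0 := by
  intro z hz
  have hne : ∀ w ∈ ball (0:ℂ) 1, g w + Complex.I ≠ 0 := by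
    intro w hw h0
    have := congrArg Complex.im h0
    simp [h1 w hw] at this
  have hn : ∀ w ∈ ball (0:ℂ) 1, ‖(g w - Complex.I) / (g w + Complex.I)‖ = 1 := by
    intro w hw
    rw [norm_div, div_eq_one_iff_eq (norm_ne_zero_iff.2 (hne w hw))]
    have : g w - Complex.I = (starRingEnd ℂ) (g w + Complex.I) := by
      apply Complex.ext <;> simp [h1 w hw]
    rw [this, Complex.norm_conj]
  have h0 : (0:ℂ) ∈ ball (0:ℂ) 1 := by simp
  have hk := const_of_max (fun w => (g w - Complex.I) / (g w + Complex.I))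
    ((hg.sub_const _).div (hg.add_const _) hne) (fun w hw => (hn w hw).le) 0 h0 (hn 0 h0).ge z hz
  rw [div_eq_div_iff (hne z hz) (hne 0 h0)] at hk
  have h2 : 2 * Complex.I * (g z - g 0) = 0 := by linear_combination hk
  have h3 : g z - g 0 = 0 := by
    rcases mul_eq_zero.1 h2 with h | h
    · simp at h
    · exact h
  exact sub_eq_zero.1 h3

theorem torus_compact : IsCompact Torus := by
  have hc : IsClosed Torus := by
    have h0 : IsClosed {z : Fin 2 → ℂ | ‖z 0‖ = 1} := isClosed_eq (by fun_prop) continuous_const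
    have h1 : IsClosed {z : Fin 2 → ℂ | ‖z 1‖ = 1} := isClosed_eq (by fun_prop) continuous_const
    exact h0.inter h1
  refine (isCompact_closedBall (0 : Fin 2 → ℂ) 1).of_isClosed_subset hc ?_
  intro z hz
  rw [mem_closedBall_zero_iff, pi_norm_le_iff_of_nonneg zero_le_one]
  intro i
  fin_cases i
  · exact hz.1.le
  · exact hz.2.le

theorem snoc3 (y : Fin 2 → ℂ) (t : ℂ) : (Fin.snoc y t : Fin 3 → ℂ) = ![y 0, y 1, t] := by
  funext i
  fin_cases i <;> rfl

open Polynomial in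
theorem evalEval_cont (q : ℂ[X][X]) : Continuous fun y : Fin 2 → ℂ => q.evalEval (y 0) (y 1) := by
  obtain ⟨Q, hQ⟩ := toMv q
  have : (fun y : Fin 2 → ℂ => q.evalEval (y 0) (y 1)) =
      fun y => MvPolynomial.eval ![y 0, y 1, 0] Q := by
    funext y; rw [hQ]; rfl
  rw [this]
  refine (MvPolynomial.continuous_eval Q).comp (continuous_pi fun i => ?_)
  fin_cases i
  · exact continuous_apply 0
  · exact continuous_apply 1
  · exact continuous_const

/-- The set where the smooth function will vanish on the torus. -/
def KA {a : ℕ → ℂ} (D : WData a) : Set (Fin 2 → ℂ) :=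
  {y | y 0 * y 1 = 1} ∪ {y | ∀ n, ‖(D.p n).evalEval (y 0) (y 1)‖ ≤ 4 * D.s n ^ 2}

theorem KA_closed {a : ℕ → ℂ} (D : WData a) : IsClosed (KA D) := by
  refine IsClosed.union (isClosed_eq (by fun_prop) continuous_const) ?_
  simp only [Set.setOf_forall]
  exact isClosed_iInter fun n => isClosed_le (evalEval_cont (D.p n)).norm continuous_const

theorem zero_bound {a : ℕ → ℂ} (D : WData a) (p : MvPolynomial (Fin 3) ℂ) :
    ∃ y ∈ Torus, y ∈ KA D ∧
      ‖MvPolynomial.eval 0 p‖ ≤ ‖MvPolynomial.eval ![y 0, y 1, 0] p‖ := by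
  obtain ⟨P, hP⟩ := ofMv p
  set S : ℕ → Set (Fin 2 → ℂ) := fun n => Torus ∩
    ((⋂ m ∈ Set.Iic n, {y | ‖(D.p m).evalEval (y 0) (y 1)‖ ≤ 4 * D.s m ^ 2}) ∩
    {y | ‖P.evalEval 0 0‖ ≤ ‖P.evalEval (y 0) (y 1)‖}) with hS
  have hcl : ∀ n, IsClosed (S n) := by
    intro n
    refine torus_compact.isClosed.inter (IsClosed.inter ?_ ?_)
    · exact isClosed_biInter fun m _ => isClosed_le (evalEval_cont (D.p m)).norm continuous_const
    · exact isClosed_le continuous_const (evalEval_cont P).norm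
  have hne : ∀ n, (S n).Nonempty := by
    intro n
    obtain ⟨e1, e2, e3, e4⟩ := w_eval0 a D.p D.s D.p0 D.pS n
    obtain ⟨z, w, hz, h0, hle⟩ := w_max (D.p n) P (2 ^ (n + 1)) (by positivity) e3 e4 e1
    obtain ⟨hw, hm⟩ := w_real D n z w hz h0
    refine ⟨![z, w], ⟨hz, hw⟩, ?_, hle⟩
    simp only [Set.mem_iInter]
    intro m hmn
    exact hm m hmn
  have hanti : ∀ n, S (n + 1) ⊆ S n := by
    rintro n y ⟨h1, h2, h3⟩
    refine ⟨h1, ?_, h3⟩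
    simp only [Set.mem_iInter] at h2 ⊢
    intro m hm
    exact h2 m (le_trans hm (Nat.le_succ n))
  obtain ⟨y, hy⟩ := IsCompact.nonempty_iInter_of_sequence_nonempty_isCompact_isClosed S hanti hne
    (torus_compact.of_isClosed_subset (hcl 0) Set.inter_subset_left) hcl
  rw [Set.mem_iInter] at hy
  refine ⟨y, (hy 0).1, Or.inr fun n => ?_, ?_⟩
  · have := (hy n).2.1
    simp only [Set.mem_iInter] at this
    exact this n (le_refl n)
  · have h := (hy 0).2.2
    have e : (![0, 0, 0] : Fin 3 → ℂ) = 0 := by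
      funext i; fin_cases i <;> rfl
    simp only [Set.mem_setOf_eq, hP] at h
    rwa [e] at h

theorem stmt3 :
    ∃ f : (Fin 2 → ℂ) → ℝ, ContDiff ℝ (⊤ : ℕ∞) f ∧
      graphR f Torus ⊂ polyHull (graphR f Torus) ∧
      NoAnalyticDisk (polyHull (graphR f Torus)) := by
  obtain ⟨a, ha0, ha1, hdense⟩ := seq_exists
  obtain ⟨D⟩ := w_exists a ha0 ha1
  obtain ⟨f, hfs, hf, -⟩ := (KA_closed D).isOpen_compl.exists_contDiff_support_eq (n := (⊤ : ℕ∞))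
  have hf0 : ∀ y, f y = 0 ↔ y ∈ KA D := by
    intro y
    have : y ∈ Function.support f ↔ y ∈ (KA D)ᶜ := by rw [hfs]
    rw [Function.mem_support, Set.mem_compl_iff] at this
    exact not_iff_not.1 this
  have hGc : IsCompact (graphR f Torus) := by
    refine torus_compact.image ?_
    have : (fun z : Fin 2 → ℂ => (Fin.snoc z ((f z : ℂ)) : Fin 3 → ℂ)) =
        fun z => ![z 0, z 1, (f z : ℂ)] := by
      funext z; exact snoc3 _ _
    rw [this]
    refine continuous_pi fun i => ?_
    fin_cases i
    · exact continuous_apply 0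
    · exact continuous_apply 1
    · exact Complex.continuous_ofReal.comp hf.continuous
  have hmem : ∀ y ∈ graphR f Torus, ∃ z ∈ Torus, y 0 = z 0 ∧ y 1 = z 1 ∧ y 2 = (f z : ℂ) := by
    rintro y ⟨z, hz, rfl⟩
    exact ⟨z, hz, rfl, rfl, rfl⟩
  have h11 : (fun _ => 1 : Fin 2 → ℂ) ∈ Torus := ⟨by simp, by simp⟩
  have hGne : (graphR f Torus).Nonempty := ⟨_, _, h11, rfl⟩
  have hiff := fun x => hull_iff hGc hGne x
  refine ⟨f, hf, ⟨?_, ?_⟩, ?_⟩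
  · intro x hx
    exact (hiff x).2 fun p => ⟨x, hx, le_rfl⟩
  · intro hsub
    have h0 : (0 : Fin 3 → ℂ) ∈ polyHull (graphR f Torus) := by
      refine (hiff 0).2 fun p => ?_
      obtain ⟨y, hy, hyK, hle⟩ := zero_bound D p
      refine ⟨![y 0, y 1, 0], ⟨y, hy, ?_⟩, hle⟩
      simp only
      rw [snoc3, (hf0 y).2 hyK, Complex.ofReal_zero]
    obtain ⟨z, hz, e, -⟩ := hmem 0 (hsub h0)
    have := hz.1
    rw [← e] at this
    simp at this
  · intro φ hφ hφS
    have hd : ∀ i, DifferentiableOn ℂ (fun z => φ z i) (ball 0 1) :=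
      fun i => (differentiableOn_pi.1 hφ) i
    have hH : ∀ z ∈ ball (0:ℂ) 1, Hl (graphR f Torus) (φ z) := fun z hz => (hiff _).1 (hφS z hz)
    have hn0 : ∀ z ∈ ball (0:ℂ) 1, ‖φ z 0‖ ≤ 1 := by
      intro z hz
      obtain ⟨y, hy, hle⟩ := hH z hz (MvPolynomial.X 0)
      obtain ⟨u, hu, e0, e1, e2⟩ := hmem y hy
      rwa [MvPolynomial.eval_X, MvPolynomial.eval_X, e0, hu.1] at hle
    have hn1 : ∀ z ∈ ball (0:ℂ) 1, ‖φ z 1‖ ≤ 1 := by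
      intro z hz
      obtain ⟨y, hy, hle⟩ := hH z hz (MvPolynomial.X 1)
      obtain ⟨u, hu, e0, e1, e2⟩ := hmem y hy
      rwa [MvPolynomial.eval_X, MvPolynomial.eval_X, e1, hu.2] at hle
    have hfib : ∀ z ∈ ball (0:ℂ) 1, (φ z 2).im = 0 ∧
        Hl (graphR f Torus ∩ {y | y 2 = φ z 2}) (φ z) := by
      intro z hz
      refine Hl_fiber hGc ?_ (hH z hz)
      intro y hy
      obtain ⟨u, hu, e0, e1, e2⟩ := hmem y hy
      rw [e2, Complex.ofReal_im]
    have hz0 : (0:ℂ) ∈ ball (0:ℂ) 1 := by simp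
    have hc2 : ∀ z ∈ ball (0:ℂ) 1, φ z 2 = φ 0 2 :=
      const_of_real (fun z => φ z 2) (hd 2) (fun z hz => (hfib z hz).1)
    -- a point of maximal modulus makes both coordinates constant
    have hmax : ∀ z1 ∈ ball (0:ℂ) 1, 1 ≤ ‖φ z1 0 * φ z1 1‖ →
        (∃ c, ∀ ζ ∈ ball (0:ℂ) 1, φ ζ 0 = c) ∧ (∃ c, ∀ ζ ∈ ball (0:ℂ) 1, φ ζ 1 = c) := by
      intro z1 hz1 hge
      rw [norm_mul] at hge
      have q0 := hn0 z1 hz1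
      have q1 := hn1 z1 hz1
      have g0 : 1 ≤ ‖φ z1 0‖ := hge.trans (mul_le_of_le_one_right (norm_nonneg _) q1)
      have g1 : 1 ≤ ‖φ z1 1‖ := hge.trans (mul_le_of_le_one_left (norm_nonneg _) q0)
      exact ⟨⟨_, const_of_max (fun z => φ z 0) (hd 0) hn0 z1 hz1 g0⟩,
        ⟨_, const_of_max (fun z => φ z 1) (hd 1) hn1 z1 hz1 g1⟩⟩
    have hcst : (∃ c, ∀ ζ ∈ ball (0:ℂ) 1, φ ζ 0 = c) ∧ (∃ c, ∀ ζ ∈ ball (0:ℂ) 1, φ ζ 1 = c) := by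
      by_cases ht : φ 0 2 = 0
      · by_cases hex : ∃ z1 ∈ ball (0:ℂ) 1, φ z1 0 * φ z1 1 = 1
        · obtain ⟨z1, hz1, h⟩ := hex
          exact hmax z1 hz1 (by rw [h, norm_one])
        · push Not at hex
          refine w_nodisc D hdense (fun z => φ z 0) (fun z => φ z 1) (hd 0) (hd 1) hn0 ?_
          intro ζ hζ n
          obtain ⟨Q, hQ⟩ := toMv (D.p n)
          have hδ : 0 < 4 * D.s n ^ 2 := by
            have := D.hs n
            positivity
          have := Hl_zero Q (4 * D.s n ^ 2) hδ ?_ ?_ (hfib ζ hζ).2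
          · rcases this with h | h
            · exact absurd h (hex ζ hζ)
            · rwa [hQ] at h
          · rintro y ⟨hy, -⟩
            obtain ⟨u, hu, e0, e1, e2⟩ := hmem y hy
            rw [e0, e1, norm_mul, hu.1, hu.2, one_mul]
          · rintro y ⟨hy, hy2⟩
            obtain ⟨u, hu, e0, e1, e2⟩ := hmem y hy
            have hy2' : y 2 = φ ζ 2 := hy2
            rw [hc2 ζ hζ, ht, e2, Complex.ofReal_eq_zero, hf0] at hy2'
            rw [hQ, e0, e1]
            rcases hy2' with h | h
            · exact Or.inl h
            · exact Or.inr (h n)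
      · refine hmax 0 hz0 (Hl_arc ?_ ?_ ?_ (hfib 0 hz0).2)
        · exact hGc.inter_right (isClosed_eq (continuous_apply 2) continuous_const)
        · rintro y ⟨hy, -⟩
          obtain ⟨u, hu, e0, e1, e2⟩ := hmem y hy
          rw [e0, e1, norm_mul, hu.1, hu.2, one_mul]
        · rintro y ⟨hy, hy2⟩ hy3
          obtain ⟨u, hu, e0, e1, e2⟩ := hmem y hy
          apply ht
          have hy2' : y 2 = φ 0 2 := hy2
          rw [e0, e1] at hy3
          rw [← hy2', e2, (hf0 u).2 (Or.inl hy3), Complex.ofReal_zero]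
    obtain ⟨⟨c, hc⟩, ⟨c', hc'⟩⟩ := hcst
    intro z hz w hw
    funext i
    fin_cases i
    · exact (hc z hz).trans (hc w hw).symm
    · exact (hc' z hz).trans (hc' w hw).symm
    · exact (hc2 z hz).trans (hc2 w hw).symm
end

section
/- There exist C^∞ functions f_1, f_2 : ℂ² → ℝ such that, letting S³ = {(z_1,z_2) ∈ ℂ² : |z_1|² + |z_2|² = 1} and G = 𝒢_f(S³) = {(z_1, z_2, f_1(z), f_2(z)) : z = (z_1,z_2) ∈ S³} ⊆ ℂ⁴, the polynomially convex hull Ĝ strictly contains G, and Ĝ contains no analytic disk. -/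
open Metric

/-- The unit sphere `S³ = {(z₁,z₂) ∈ ℂ² : |z₁|² + |z₂|² = 1}`. -/
def SphS3 : Set (Fin 2 → ℂ) := {z | ‖z 0‖ ^ 2 + ‖z 1‖ ^ 2 = 1}

/-- The graph of a pair of real-valued functions over a subset of `ℂ²`, inside `ℂ⁴`. -/
noncomputable def graphR2 (f₁ f₂ : (Fin 2 → ℂ) → ℝ) (E : Set (Fin 2 → ℂ)) :
    Set (Fin (2 + 2) → ℂ) :=
  (fun z => Fin.append z ![(f₁ z : ℂ), (f₂ z : ℂ)]) '' E


lemma hull_le {m : ℕ} {K : Set (Fin m → ℂ)} {z : Fin m → ℂ} (hz : z ∈ polyHull K)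
    (p : MvPolynomial (Fin m) ℂ) {M : ℝ} (hM : 0 ≤ M)
    (h : ∀ w ∈ K, ‖MvPolynomial.eval w p‖ ≤ M) : ‖MvPolynomial.eval z p‖ ≤ M := by
  refine (hz p).trans (Real.sSup_le ?_ hM)
  rintro _ ⟨w, hw, rfl⟩
  exact h w hw

lemma cont_eval {m : ℕ} (p : MvPolynomial (Fin m) ℂ) :
    Continuous (fun w : Fin m → ℂ => MvPolynomial.eval w p) :=
  MvPolynomial.continuous_eval p

lemma bdd_eval {m : ℕ} {K : Set (Fin m → ℂ)} (hK : IsCompact K) (p : MvPolynomial (Fin m) ℂ) :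
    BddAbove ((fun w => ‖MvPolynomial.eval w p‖) '' K) :=
  (hK.image (cont_eval p).norm).bddAbove

lemma exists_bdd {m : ℕ} {K : Set (Fin m → ℂ)} (hK : IsCompact K) (p : MvPolynomial (Fin m) ℂ) :
    ∃ B : ℝ, 0 < B ∧ ∀ w ∈ K, ‖MvPolynomial.eval w p‖ ≤ B := by
  obtain ⟨B, hB⟩ := bdd_eval hK p
  refine ⟨max B 1, by positivity, fun w hw => le_max_of_le_left (hB ⟨w, hw, rfl⟩)⟩

lemma hull_re {m : ℕ} {K : Set (Fin m → ℂ)} (hK : IsCompact K) {z : Fin m → ℂ}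
    (hz : z ∈ polyHull K) (p : MvPolynomial (Fin m) ℂ) {A : ℝ}
    (h : ∀ w ∈ K, (MvPolynomial.eval w p).re ≤ A) : (MvPolynomial.eval z p).re ≤ A := by
  by_contra! hc
  obtain ⟨B, hB0, hB⟩ := exists_bdd hK p
  set δ := (MvPolynomial.eval z p).re - A with hδ
  have hδ0 : 0 < δ := by simp only [hδ]; linarith
  set N : ℝ := B + |A| + B ^ 2 / δ with hN
  have hq : 0 < B ^ 2 / δ := by positivity
  have hAN : B + B ^ 2 / δ ≤ A + N := by
    have := neg_abs_le A
    simp only [hN]; linarith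
  have hNB : B ≤ N := by
    have := abs_nonneg A
    simp only [hN]; linarith
  have key := hull_le hz (p + MvPolynomial.C (N : ℂ)) (M := Real.sqrt ((A + N) ^ 2 + B ^ 2))
    (Real.sqrt_nonneg _) (by
      intro w hw
      apply Real.le_sqrt_of_sq_le
      rw [Complex.sq_norm, Complex.normSq_apply]
      simp only [map_add, MvPolynomial.eval_C, Complex.add_re, Complex.ofReal_re, Complex.add_im,
        Complex.ofReal_im, add_zero]
      have h1 := h w hw
      have h2 := (Complex.abs_re_le_norm _).trans (hB w hw)
      have h3 := (Complex.abs_im_le_norm _).trans (hB w hw)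
      have h4 := abs_le.1 h2
      have h5 := sq_le_sq' (abs_le.1 h3).1 (abs_le.1 h3).2
      nlinarith)
  have k2 : (MvPolynomial.eval z p).re + N ≤ Real.sqrt ((A + N) ^ 2 + B ^ 2) := by
    refine le_trans ?_ key
    refine le_trans ?_ (Complex.re_le_norm _)
    simp
  have k3 : (A + N + δ) ^ 2 ≤ (A + N) ^ 2 + B ^ 2 := by
    rw [← Real.sq_sqrt (show 0 ≤ (A + N) ^ 2 + B ^ 2 by positivity)]
    apply pow_le_pow_left₀
    · linarith
    · simp only [hδ]; linarith
  have k4 : B ^ 2 ≤ δ * (A + N) := by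
    have : B ^ 2 = δ * (B ^ 2 / δ) := by field_simp
    rw [this]
    apply mul_le_mul_of_nonneg_left _ hδ0.le
    linarith
  nlinarith

lemma hull_real {m : ℕ} {K : Set (Fin m → ℂ)} (hK : IsCompact K) {z : Fin m → ℂ}
    (hz : z ∈ polyHull K) (q : MvPolynomial (Fin m) ℂ)
    (h : ∀ w ∈ K, (MvPolynomial.eval w q).im = 0) : (MvPolynomial.eval z q).im = 0 := by
  have h1 := hull_re hK hz (MvPolynomial.C Complex.I * q) (A := 0)
    (by intro w hw; simp [h w hw])
  have h2 := hull_re hK hz (MvPolynomial.C (-Complex.I) * q) (A := 0)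
    (by intro w hw; simp [h w hw])
  simp at h1 h2
  linarith

lemma hull_fiber {m : ℕ} {K : Set (Fin m → ℂ)} (hK : IsCompact K) {z : Fin m → ℂ}
    (hz : z ∈ polyHull K) (q : MvPolynomial (Fin m) ℂ)
    (h : ∀ w ∈ K, (MvPolynomial.eval w q).im = 0) :
    z ∈ polyHull {w ∈ K | MvPolynomial.eval w q = MvPolynomial.eval z q} := by
  intro p
  set c := MvPolynomial.eval z q with hc
  have hcim : c.im = 0 := hull_real hK hz q h
  set L := {w ∈ K | MvPolynomial.eval w q = c} with hL
  set M := sSup ((fun w => ‖MvPolynomial.eval w p‖) '' L) with hM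
  have hM0 : 0 ≤ M := Real.sSup_nonneg (by rintro _ ⟨w, _, rfl⟩; positivity)
  by_contra! hlt
  set M' := (M + ‖MvPolynomial.eval z p‖) / 2 with hM'
  have hMM' : M < M' := by simp only [hM']; linarith
  have hM'p : M' < ‖MvPolynomial.eval z p‖ := by simp only [hM']; linarith
  obtain ⟨B, hB0, hB⟩ := exists_bdd hK p
  obtain ⟨R, hR0, hR⟩ := exists_bdd hK ((q - MvPolynomial.C c) ^ 2)
  set θ : MvPolynomial (Fin m) ℂ := 1 - MvPolynomial.C ((R : ℂ)⁻¹) * (q - MvPolynomial.C c) ^ 2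
    with hθ
  have hθv : ∀ w ∈ K, MvPolynomial.eval w θ =
      ((1 - R⁻¹ * ((MvPolynomial.eval w q).re - c.re) ^ 2 : ℝ) : ℂ) := by
    intro w hw
    have e1 : MvPolynomial.eval w q = ((MvPolynomial.eval w q).re : ℂ) :=
      Complex.ext rfl (by simp [h w hw])
    have e2 : c = (c.re : ℂ) := Complex.ext rfl (by simp [hcim])
    simp only [hθ, map_sub, map_mul, map_pow, MvPolynomial.eval_C, map_one]
    rw [e1, e2]
    push_cast
    simp
  have hsq : ∀ w ∈ K, ((MvPolynomial.eval w q).re - c.re) ^ 2 ≤ R := by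
    intro w hw
    have := hR w hw
    simp only [map_pow, map_sub, MvPolynomial.eval_C, norm_pow] at this
    refine le_trans ?_ this
    rw [← Complex.sub_re, sq_le_sq]
    simpa using Complex.abs_re_le_norm (MvPolynomial.eval w q - c)
  have hnorm : ∀ w ∈ K, ‖MvPolynomial.eval w θ‖ =
      1 - R⁻¹ * ((MvPolynomial.eval w q).re - c.re) ^ 2 := by
    intro w hw
    rw [hθv w hw, Complex.norm_real, Real.norm_of_nonneg]
    have := mul_le_mul_of_nonneg_left (hsq w hw) (inv_nonneg.2 hR0.le)
    rw [inv_mul_cancel₀ hR0.ne'] at this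
    linarith
  have hle1 : ∀ w ∈ K, ‖MvPolynomial.eval w θ‖ ≤ 1 := by
    intro w hw
    rw [hnorm w hw]
    have : 0 ≤ R⁻¹ * ((MvPolynomial.eval w q).re - c.re) ^ 2 := by positivity
    linarith
  set K' := {w ∈ K | M' ≤ ‖MvPolynomial.eval w p‖} with hK'
  have hK'c : IsCompact K' :=
    hK.inter_right (isClosed_le continuous_const (cont_eval p).norm)
  have hlt1 : ∀ w ∈ K', ‖MvPolynomial.eval w θ‖ < 1 := by
    rintro w ⟨hw, hw'⟩
    rw [hnorm w hw]
    have hne : (MvPolynomial.eval w q).re - c.re ≠ 0 := by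
      intro h0
      have : w ∈ L := ⟨hw, Complex.ext (by linarith) (by rw [h w hw, hcim])⟩
      have hLK : L ⊆ K := fun x hx => hx.1
      have : ‖MvPolynomial.eval w p‖ ≤ M :=
        le_csSup ((bdd_eval hK p).mono (Set.image_mono hLK)) ⟨w, this, rfl⟩
      linarith
    have : 0 < R⁻¹ * ((MvPolynomial.eval w q).re - c.re) ^ 2 := by positivity
    linarith
  obtain ⟨t, ht0, ht1, ht⟩ : ∃ t : ℝ, 0 ≤ t ∧ t < 1 ∧ ∀ w ∈ K', ‖MvPolynomial.eval w θ‖ ≤ t := by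
    rcases K'.eq_empty_or_nonempty with h0 | h0
    · exact ⟨0, le_rfl, one_pos, by simp [h0]⟩
    · obtain ⟨x, hx, hxm⟩ := hK'c.exists_isMaxOn h0 (cont_eval θ).norm.continuousOn
      exact ⟨_, norm_nonneg _, hlt1 x hx, fun w hw => hxm hw⟩
  obtain ⟨k, hk⟩ := exists_pow_lt_of_lt_one (show 0 < M' / B from div_pos (by linarith) hB0) ht1
  have key := hull_le hz (p * θ ^ k) (M := M') (by linarith) (by
    intro w hw
    simp only [map_mul, map_pow, norm_mul, norm_pow]
    by_cases hw' : w ∈ K'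
    · have h1 : ‖MvPolynomial.eval w θ‖ ^ k ≤ t ^ k :=
        pow_le_pow_left₀ (norm_nonneg _) (ht w hw') k
      have h2 := hB w hw
      calc _ ≤ B * t ^ k := by gcongr
        _ ≤ B * (M' / B) := by gcongr
        _ = M' := by field_simp
    · have h1 : ‖MvPolynomial.eval w p‖ < M' := by
        by_contra! h3
        exact hw' ⟨hw, h3⟩
      have h2 : ‖MvPolynomial.eval w θ‖ ^ k ≤ 1 := pow_le_one₀ (norm_nonneg _) (hle1 w hw)
      calc _ ≤ ‖MvPolynomial.eval w p‖ * 1 := by gcongr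
        _ ≤ M' := by linarith)
  have hz1 : MvPolynomial.eval z θ = 1 := by simp [hθ, ← hc]
  simp only [map_mul, map_pow, hz1, one_pow, mul_one] at key
  linarith

lemma hull_rename {m n : ℕ} (e : Fin m → Fin n) {K : Set (Fin n → ℂ)} {z : Fin n → ℂ}
    (hz : z ∈ polyHull K) : z ∘ e ∈ polyHull ((fun w => w ∘ e) '' K) := by
  intro p
  have := hz (MvPolynomial.rename e p)
  simpa only [MvPolynomial.eval_rename, Set.image_image] using this

lemma hull_circle {K : Set (Fin 2 → ℂ)} (hK : IsCompact K) {R : ℝ} (hR : 0 < R)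
    (hKR : ∀ x ∈ K, ‖x 1‖ = R) {ζ : ℂ} (hζ : ‖ζ‖ = R) (hKζ : ∀ x ∈ K, x 1 ≠ ζ)
    {x : Fin 2 → ℂ} (hx : x ∈ polyHull K) : ‖x 1‖ = R := by
  have hle : ‖x 1‖ ≤ R := by
    simpa using hull_le hx (MvPolynomial.X 1) hR.le (by intro w hw; simp [hKR w hw])
  by_contra hne
  have hlt : ‖x 1‖ < R := lt_of_le_of_ne hle hne
  have hζ0 : ζ ≠ 0 := by rw [← norm_pos_iff, hζ]; exact hR
  obtain ⟨δ, hδ0, hδ⟩ : ∃ δ : ℝ, 0 < δ ∧ ∀ w ∈ K, δ ≤ ‖1 - w 1 / ζ‖ := by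
    rcases K.eq_empty_or_nonempty with h0 | h0
    · exact ⟨1, one_pos, by simp [h0]⟩
    · obtain ⟨y, hy, hym⟩ := hK.exists_isMinOn h0
        (f := fun w : Fin 2 → ℂ => ‖1 - w 1 / ζ‖) (by fun_prop)
      refine ⟨_, ?_, fun w hw => hym hw⟩
      rw [norm_pos_iff, sub_ne_zero]
      intro h1
      apply hKζ y hy
      field_simp at h1
      exact h1.symm
  set y := x 1 / ζ with hy
  have hy1 : ‖y‖ < 1 := by rw [hy, norm_div, hζ]; exact (div_lt_one hR).2 hlt
  set c := 1 - ‖y‖ ^ 2 with hc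
  have hc0 : 0 < c := by
    have := norm_nonneg y
    simp only [hc]; nlinarith
  have hc1 : c ≤ 1 := by simp only [hc]; nlinarith [norm_nonneg y]
  -- choose s
  obtain ⟨s, hs0, hs1, hsδ, hsc⟩ : ∃ s : ℝ, 0 < s ∧ s < 1 ∧ 1 - s ≤ δ / 2 ∧
      8 * (1 - s) ≤ c / 16 * δ ^ 2 := by
    set η := min (1 / 2) (min (δ / 2) (c * δ ^ 2 / 128)) with hη
    have h1 : 0 < η := by positivity
    have h2 : η ≤ 1 / 2 := min_le_left _ _
    have h3 : η ≤ δ / 2 := (min_le_right _ _).trans (min_le_left _ _)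
    have h4 : η ≤ c * δ ^ 2 / 128 := (min_le_right _ _).trans (min_le_right _ _)
    exact ⟨1 - η, by linarith, by linarith, by linarith, by linarith⟩
  obtain ⟨n, hn⟩ := exists_pow_lt_of_lt_one
    (show 0 < c / 64 * (1 - s) from mul_pos (by positivity) (by linarith)) hs1
  set P : MvPolynomial (Fin 2) ℂ := 2 * ∑ k ∈ Finset.range n,
    (MvPolynomial.C ((s : ℂ) / ζ) * MvPolynomial.X 1) ^ k - 1 with hP
  have hu : ∀ v : ℂ, ‖v‖ ≤ 1 → ‖(s : ℂ) * v‖ ≤ s := by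
    intro v hv
    rw [norm_mul, Complex.norm_real, Real.norm_of_nonneg hs0.le]
    nlinarith
  have hPv : ∀ w : Fin 2 → ℂ, ‖w 1 / ζ‖ ≤ 1 →
      |(MvPolynomial.eval w P).re -
        (1 - s ^ 2 * ‖w 1 / ζ‖ ^ 2) / ‖1 - s * (w 1 / ζ)‖ ^ 2| ≤ c / 32 := by
    intro w hw
    set v := w 1 / ζ with hv
    have hsv := hu v hw
    have hone : 1 - s ≤ ‖1 - (s : ℂ) * v‖ := by
      have := norm_sub_norm_le (1 : ℂ) ((s : ℂ) * v)
      rw [norm_one] at this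
      linarith
    have hne1 : (1 : ℂ) - s * v ≠ 0 := by
      rw [← norm_pos_iff]; linarith
    have e1 : MvPolynomial.eval w P = (1 + s * v) / (1 - s * v) - 2 * (s * v) ^ n / (1 - s * v) := by
      have : MvPolynomial.eval w P = 2 * ∑ k ∈ Finset.range n, (s * v) ^ k - 1 := by
        simp only [hP, map_sub, map_mul, map_ofNat, map_sum, map_pow, MvPolynomial.eval_C,
          MvPolynomial.eval_X, map_one]
        congr 2
        apply Finset.sum_congr rfl
        intro k _
        rw [hv]; ring
      rw [this, geom_sum_eq (by intro h; apply hne1; rw [h]; ring)]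
      have : (s : ℂ) * v - 1 ≠ 0 := by
        intro h; apply hne1; linear_combination -h
      field_simp
      ring
    have e2 : ((1 + (s : ℂ) * v) / (1 - s * v)).re =
        (1 - s ^ 2 * ‖v‖ ^ 2) / ‖1 - s * v‖ ^ 2 := by
      rw [Complex.sq_norm, Complex.sq_norm, Complex.div_re, ← add_div]
      congr 1
      simp [Complex.normSq_apply]
      ring
    rw [e1, Complex.sub_re, e2, sub_sub_cancel_left, abs_neg]
    refine (Complex.abs_re_le_norm _).trans ?_
    rw [norm_div, norm_mul, norm_pow, div_le_iff₀ (by linarith)]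
    have h5 : ‖(s : ℂ) * v‖ ^ n ≤ s ^ n := pow_le_pow_left₀ (norm_nonneg _) hsv n
    have h6 : c / 32 * (1 - s) ≤ c / 32 * ‖1 - (s : ℂ) * v‖ := by gcongr
    have h7 : ‖(2 : ℂ)‖ = 2 := by simp
    rw [h7]
    linarith
  have key := hull_re hK hx P (A := c / 16 + c / 32) (by
    intro w hw
    have hw1 : ‖w 1 / ζ‖ = 1 := by rw [norm_div, hζ, hKR w hw]; field_simp
    have h1 := (abs_le.1 (hPv w hw1.le)).2
    have h2 : (1 - s ^ 2 * ‖w 1 / ζ‖ ^ 2) / ‖1 - s * (w 1 / ζ)‖ ^ 2 ≤ c / 16 := by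
      have h3 : δ / 2 ≤ ‖1 - s * (w 1 / ζ)‖ := by
        have e : 1 - w 1 / ζ = (1 - s * (w 1 / ζ)) - ((1 - s : ℝ) : ℂ) * (w 1 / ζ) := by
          push_cast; ring
        have h4 := hδ w hw
        rw [e] at h4
        have h5 := h4.trans (norm_sub_le _ _)
        rw [norm_mul, hw1, Complex.norm_real, Real.norm_of_nonneg (by linarith)] at h5
        linarith
      have h30 : 0 < ‖1 - s * (w 1 / ζ)‖ := lt_of_lt_of_le (half_pos hδ0) h3
      rw [hw1, div_le_iff₀ (by positivity)]
      have h6 : (δ / 2) ^ 2 ≤ ‖1 - s * (w 1 / ζ)‖ ^ 2 := pow_le_pow_left₀ (by positivity) h3 2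
      have h7 : c / 16 * (δ / 2) ^ 2 ≤ c / 16 * ‖1 - s * (w 1 / ζ)‖ ^ 2 := by gcongr
      nlinarith
    linarith)
  have h1 := (abs_le.1 (hPv x hy1.le)).1
  have h2 : c / 4 ≤ (1 - s ^ 2 * ‖x 1 / ζ‖ ^ 2) / ‖1 - s * (x 1 / ζ)‖ ^ 2 := by
    rw [← hy]
    have hne : 0 < ‖1 - (s : ℂ) * y‖ := by
      have := norm_sub_norm_le (1 : ℂ) ((s : ℂ) * y)
      have h3 := hu y hy1.le
      rw [norm_one] at this
      linarith
    have h4 : ‖1 - (s : ℂ) * y‖ ≤ 2 := by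
      have := norm_sub_le (1 : ℂ) ((s : ℂ) * y)
      have h3 := hu y hy1.le
      rw [norm_one] at this
      linarith
    rw [le_div_iff₀ (by positivity)]
    have h5 : ‖1 - (s : ℂ) * y‖ ^ 2 ≤ 2 ^ 2 := pow_le_pow_left₀ hne.le h4 2
    have h6 : s ^ 2 ≤ 1 := pow_le_one₀ hs0.le hs1.le
    have h7 : s ^ 2 * ‖y‖ ^ 2 ≤ ‖y‖ ^ 2 := by nlinarith [sq_nonneg ‖y‖]
    nlinarith
  linarith

/-- coefficients -/
noncomputable def cc (j : ℕ) : ℝ := (1 / 16) ^ (4 ^ j)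

/-- radicands -/
noncomputable def QQ (a : ℕ → ℂ) (j : ℕ) (z : ℂ) : ℂ :=
  (∏ i ∈ Finset.range j, (z - a i)) ^ 2 * (z - a j)

/-- valid choices of roots -/
def Val (a : ℕ → ℂ) (z : ℂ) (s : ℕ → ℂ) : Prop := ∀ j, s j ^ 2 = QQ a j z

/-- partial sums -/
noncomputable def part (n : ℕ) (s : ℕ → ℂ) : ℂ :=
  -1 / 2 + ∑ j ∈ Finset.range n, (cc j : ℂ) * s j

/-- full sum -/
noncomputable def full (s : ℕ → ℂ) : ℂ := -1 / 2 + ∑' j, (cc j : ℂ) * s j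

lemma cc_pos (j : ℕ) : 0 < cc j := by unfold cc; positivity

lemma cc_succ (j : ℕ) : cc (j + 1) ≤ cc j / 16 := by
  have h : cc (j + 1) = cc j * cc j ^ 3 := by
    unfold cc; rw [← pow_mul, ← pow_add]; congr 1; ring
  have h1 : cc j ≤ 1 / 16 := by
    unfold cc
    exact pow_le_of_le_one (by norm_num) (by norm_num) (by positivity)
  have h2 : cc j ^ 3 ≤ (1 / 16) ^ 3 := pow_le_pow_left₀ (cc_pos j).le h1 3
  have := cc_pos j
  rw [h]; nlinarith

lemma val_exists (a : ℕ → ℂ) (z : ℂ) : ∃ s, Val a z s := by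
  have : ∀ j, ∃ x : ℂ, x ^ 2 = QQ a j z := fun j =>
    IsAlgClosed.exists_pow_nat_eq _ (by norm_num)
  choose s hs using this
  exact ⟨s, hs⟩

lemma QQ_succ {a : ℕ → ℂ} (j : ℕ) (z : ℂ) : QQ a (j + 1) z = QQ a j z * ((z - a j) * (z - a (j + 1))) := by
  unfold QQ; rw [Finset.prod_range_succ]; ring

lemma sub_le_two {a : ℕ → ℂ} (ha : ∀ j, ‖a j‖ ≤ 1) {z : ℂ} (hz : ‖z‖ ≤ 1) (j : ℕ) : ‖z - a j‖ ≤ 2 := by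
  have := norm_sub_le z (a j)
  linarith [ha j]

lemma val_succ {a : ℕ → ℂ} (ha : ∀ j, ‖a j‖ ≤ 1) {z : ℂ} (hz : ‖z‖ ≤ 1) {s : ℕ → ℂ} (hs : Val a z s) (j : ℕ) :
    ‖s (j + 1)‖ ≤ 2 * ‖s j‖ := by
  have h1 : ‖s (j + 1)‖ ^ 2 = ‖s j‖ ^ 2 * (‖z - a j‖ * ‖z - a (j + 1)‖) := by
    rw [← norm_pow, ← norm_pow, hs, hs, QQ_succ, norm_mul, norm_mul]
  have h2 : ‖z - a j‖ * ‖z - a (j + 1)‖ ≤ 2 * 2 :=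
    mul_le_mul (sub_le_two ha hz j) (sub_le_two ha hz _) (norm_nonneg _) (by norm_num)
  refine (sq_le_sq₀ (norm_nonneg _) (by positivity)).1 ?_
  rw [h1, mul_pow]
  nlinarith [sq_nonneg ‖s j‖]

lemma val_zero {a : ℕ → ℂ} (ha : ∀ j, ‖a j‖ ≤ 1) {z : ℂ} (hz : ‖z‖ ≤ 1) {s : ℕ → ℂ} (hs : Val a z s) : ‖s 0‖ ≤ 2 := by
  have h1 : ‖s 0‖ ^ 2 = ‖z - a 0‖ := by
    rw [← norm_pow, hs]; simp [QQ]
  have := sub_le_two ha hz 0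
  nlinarith [norm_nonneg (s 0)]

lemma val_bound {a : ℕ → ℂ} (ha : ∀ j, ‖a j‖ ≤ 1) {z : ℂ} (hz : ‖z‖ ≤ 1) {s : ℕ → ℂ} (hs : Val a z s) (j : ℕ) :
    ‖s j‖ ≤ 2 ^ (j + 1) := by
  induction j with
  | zero => simpa using val_zero ha hz hs
  | succ j ih =>
    have := val_succ ha hz hs j
    rw [pow_succ]; linarith

lemma u_succ {a : ℕ → ℂ} (ha : ∀ j, ‖a j‖ ≤ 1) {z : ℂ} (hz : ‖z‖ ≤ 1) {s : ℕ → ℂ} (hs : Val a z s) (j : ℕ) :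
    cc (j + 1) * ‖s (j + 1)‖ ≤ (1 / 8) * (cc j * ‖s j‖) := by
  have h1 := val_succ ha hz hs j
  have h2 := cc_succ j
  have h3 := cc_pos j
  calc _ ≤ cc j / 16 * (2 * ‖s j‖) := by gcongr
    _ = _ := by ring

lemma u_geom {a : ℕ → ℂ} (ha : ∀ j, ‖a j‖ ≤ 1) {z : ℂ} (hz : ‖z‖ ≤ 1) {s : ℕ → ℂ} (hs : Val a z s) (n k : ℕ) :
    cc (n + k) * ‖s (n + k)‖ ≤ (cc n * ‖s n‖) * (1 / 8) ^ k := by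
  induction k with
  | zero => simp
  | succ k ih =>
    have := u_succ ha hz hs (n + k)
    rw [← add_assoc, pow_succ]; linarith

lemma geo_sum : HasSum (fun k : ℕ => ((1 : ℝ) / 8) ^ k) (8 / 7) := by
  have := hasSum_geometric_of_lt_one (r := (1 : ℝ) / 8) (by norm_num) (by norm_num)
  convert this using 1; norm_num

lemma u_summable {a : ℕ → ℂ} (ha : ∀ j, ‖a j‖ ≤ 1) {z : ℂ} (hz : ‖z‖ ≤ 1) {s : ℕ → ℂ} (hs : Val a z s) :
    Summable (fun j => (cc j : ℂ) * s j) := by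
  apply Summable.of_norm_bounded (g := fun k => (cc 0 * ‖s 0‖) * (1 / 8) ^ k)
    (geo_sum.summable.mul_left _)
  intro k
  have := u_geom ha hz hs 0 k
  rw [norm_mul, Complex.norm_real, Real.norm_of_nonneg (cc_pos k).le]
  simpa using this

lemma tail_le {a : ℕ → ℂ} (ha : ∀ j, ‖a j‖ ≤ 1) {z : ℂ} (hz : ‖z‖ ≤ 1) {s : ℕ → ℂ} (hs : Val a z s) (n : ℕ) :
    ‖full s - part n s‖ ≤ 2 * (cc n * ‖s n‖) := by
  have hsum := u_summable ha hz hs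
  have e : full s - part n s = ∑' k, (cc (n + k) : ℂ) * s (n + k) := by
    unfold full part
    rw [← hsum.sum_add_tsum_nat_add n]
    simp only [add_comm n]
    ring
  rw [e]
  have h1 : HasSum (fun k : ℕ => (cc n * ‖s n‖) * ((1 : ℝ) / 8) ^ k) ((cc n * ‖s n‖) * (8 / 7)) :=
    geo_sum.mul_left _
  refine (tsum_of_norm_bounded h1 ?_).trans ?_
  · intro k
    have := u_geom ha hz hs n k
    rw [norm_mul, Complex.norm_real, Real.norm_of_nonneg (cc_pos _).le]
    exact this
  · have : 0 ≤ cc n * ‖s n‖ := mul_nonneg (cc_pos n).le (norm_nonneg _)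
    linarith

lemma sum_le {a : ℕ → ℂ} (ha : ∀ j, ‖a j‖ ≤ 1) {z : ℂ} (hz : ‖z‖ ≤ 1) {s : ℕ → ℂ} (hs : Val a z s) (n : ℕ) :
    ∑ j ∈ Finset.range n, cc j * ‖s j‖ ≤ 1 / 4 := by
  have h0 : cc 0 * ‖s 0‖ ≤ 1 / 8 := by
    have := val_zero ha hz hs
    have h : cc 0 = 1 / 16 := by simp [cc]
    rw [h]; linarith
  calc ∑ j ∈ Finset.range n, cc j * ‖s j‖
      ≤ ∑ j ∈ Finset.range n, (cc 0 * ‖s 0‖) * (1 / 8) ^ j := by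
        apply Finset.sum_le_sum
        intro j _
        simpa using u_geom ha hz hs 0 j
    _ ≤ (cc 0 * ‖s 0‖) * (8 / 7) := by
        rw [← Finset.mul_sum]
        apply mul_le_mul_of_nonneg_left _ (mul_nonneg (cc_pos 0).le (norm_nonneg _))
        exact sum_le_hasSum _ (fun _ _ => by positivity) geo_sum
    _ ≤ 1 / 4 := by linarith

lemma full_near {a : ℕ → ℂ} (ha : ∀ j, ‖a j‖ ≤ 1) {z : ℂ} (hz : ‖z‖ ≤ 1) {s : ℕ → ℂ} (hs : Val a z s) :
    ‖full s + 1 / 2‖ ≤ 1 / 4 := by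
  have h := tail_le ha hz hs 0
  have h0 := val_zero ha hz hs
  have hc : cc 0 = 1 / 16 := by simp [cc]
  have e : full s - part 0 s = full s + 1 / 2 := by simp [part]; ring
  rw [e, hc] at h
  linarith


lemma cont_sqrt {T : Type*} [TopologicalSpace T] {σ x q : T → ℂ} (hx : Continuous x)
    (hq : Continuous q) (h1 : ∀ t, σ t ^ 2 = q t) (h2 : ∀ t, ‖x t - σ t‖ ≤ ‖σ t‖ / 4) :
    Continuous σ := by
  rw [continuous_iff_continuousAt]
  intro t0
  have hqt : Filter.Tendsto q (nhds t0) (nhds (q t0)) := hq.continuousAt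
  have hxt : Filter.Tendsto x (nhds t0) (nhds (x t0)) := hx.continuousAt
  by_cases h0 : σ t0 = 0
  · have hq0 : q t0 = 0 := by rw [← h1, h0]; simp
    rw [ContinuousAt, h0, tendsto_zero_iff_norm_tendsto_zero]
    have e : (fun t => ‖σ t‖) = fun t => Real.sqrt ‖q t‖ := by
      funext t
      rw [← h1, norm_pow, Real.sqrt_sq (norm_nonneg _)]
    rw [e]
    have := (Real.continuous_sqrt.tendsto _).comp hqt.norm
    simpa [hq0, Function.comp_def] using this
  · have hp : 0 < ‖σ t0‖ := norm_pos_iff.2 h0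
    rw [ContinuousAt, tendsto_iff_norm_sub_tendsto_zero]
    have hlim : Filter.Tendsto (fun t => ‖q t - q t0‖ / ‖σ t0‖) (nhds t0) (nhds 0) := by
      have := (tendsto_iff_norm_sub_tendsto_zero.1 hqt).div_const ‖σ t0‖
      simpa using this
    apply squeeze_zero' (Filter.Eventually.of_forall fun t => norm_nonneg _) _ hlim
    have hev : ∀ᶠ t in nhds t0, ‖x t - x t0‖ < ‖σ t0‖ / 4 :=
      (tendsto_iff_norm_sub_tendsto_zero.1 hxt).eventually_lt_const (by positivity)
    filter_upwards [hev] with t ht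
    have a1 : ‖σ t - σ t0‖ ≤ ‖σ t‖ / 4 + ‖σ t0‖ / 4 + ‖x t - x t0‖ := by
      have e : σ t - σ t0 = -(x t - σ t) + (x t0 - σ t0) + (x t - x t0) := by ring
      rw [e]
      refine (norm_add₃_le).trans ?_
      rw [norm_neg]
      have := h2 t
      have := h2 t0
      linarith
    have a2 : 2 * ‖σ t0‖ ≤ ‖σ t + σ t0‖ + ‖σ t - σ t0‖ := by
      have e : 2 * σ t0 = (σ t + σ t0) - (σ t - σ t0) := by ring
      have := norm_sub_le (σ t + σ t0) (σ t - σ t0)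
      rw [← e, norm_mul] at this
      simpa using this
    have a3 : ‖σ t‖ ≤ ‖σ t + σ t0‖ + ‖σ t0‖ := by
      have := norm_sub_le (σ t + σ t0) (σ t0)
      simpa using this
    have a4 : ‖σ t0‖ ≤ ‖σ t + σ t0‖ := by linarith
    rw [le_div_iff₀ hp]
    have e : q t - q t0 = (σ t - σ t0) * (σ t + σ t0) := by rw [← h1, ← h1]; ring
    rw [e, norm_mul]
    gcongr

lemma QQ_cont (a : ℕ → ℂ) (j : ℕ) : Continuous (QQ a j) := by
  unfold QQ; fun_prop

lemma s_cont {a : ℕ → ℂ} (ha : ∀ j, ‖a j‖ ≤ 1) {T : Type*} [TopologicalSpace T] {ζ ω : T → ℂ}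
    (hζ : Continuous ζ) (hω : Continuous ω) (hζ1 : ∀ t, ‖ζ t‖ ≤ 1) {s : T → ℕ → ℂ}
    (hs : ∀ t, Val a (ζ t) (s t)) (hw : ∀ t, ω t = full (s t)) (n : ℕ) :
    Continuous (fun t => s t n) := by
  induction n using Nat.strong_induction_on with
  | _ n ih =>
    have hg : Continuous (fun t => (ω t - part n (s t)) / (cc n : ℂ)) := by
      apply Continuous.div_const
      apply hω.sub
      unfold part
      apply continuous_const.add
      apply continuous_finsetSum
      intro i hi
      exact continuous_const.mul (ih i (Finset.mem_range.1 hi))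
    refine cont_sqrt hg ((QQ_cont a n).comp hζ) (fun t => hs t n) ?_
    intro t
    have hc := cc_pos n
    have hcn : (cc n : ℂ) ≠ 0 := by exact_mod_cast hc.ne'
    have e : (ω t - part n (s t)) / (cc n : ℂ) - s t n =
        (full (s t) - part (n + 1) (s t)) / (cc n : ℂ) := by
      rw [hw]
      unfold part
      rw [Finset.sum_range_succ]
      field_simp
      ring
    rw [e, norm_div, Complex.norm_real, Real.norm_of_nonneg hc.le, div_le_iff₀ hc]
    have h1 := tail_le ha (hζ1 t) (hs t) (n + 1)
    have h2 := u_succ ha (hζ1 t) (hs t) n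
    linarith

lemma no_sqrt {σ : ℂ → ℂ} {z0 : ℂ} {r : ℝ} (hr : 0 < r) (hc : ContinuousOn σ (ball z0 r))
    (h : ∀ z ∈ ball z0 r, σ z ^ 2 = z - z0) : False := by
  set ρ := r / 2 with hρ
  have hρ0 : 0 < ρ := by positivity
  set γ : ℝ → ℂ := fun θ => z0 + ρ * Complex.exp (θ * Complex.I) with hγ
  have hγm : ∀ θ, γ θ ∈ ball z0 r := by
    intro θ
    simp only [hγ, mem_ball, dist_eq_norm, add_sub_cancel_left, norm_mul, Complex.norm_real,
      Complex.norm_exp_ofReal_mul_I, Real.norm_of_nonneg hρ0.le]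
    simp only [hρ]; linarith
  have hγc : Continuous γ := by fun_prop
  set g : ℝ → ℂ := fun θ => σ (γ θ) * Complex.exp (-(θ / 2) * Complex.I) with hg
  have hgc : Continuous g := by
    apply Continuous.mul
    · exact hc.comp_continuous hγc hγm
    · fun_prop
  have hg2 : ∀ θ, g θ ^ 2 = ρ := by
    intro θ
    have e1 : γ θ - z0 = ρ * Complex.exp (θ * Complex.I) := by simp [hγ]
    simp only [hg]
    rw [mul_pow, h _ (hγm θ), ← Complex.exp_nat_mul, e1, mul_assoc, ← Complex.exp_add]
    have : (θ : ℂ) * Complex.I + ((2 : ℕ) : ℂ) * (-(θ / 2) * Complex.I) = 0 := by push_cast; ring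
    rw [this]; simp
  have hgne : ∀ θ, g θ ≠ 0 := by
    intro θ h0
    have := hg2 θ
    rw [h0] at this
    have h2 : (ρ : ℂ) ≠ 0 := by exact_mod_cast hρ0.ne'
    apply h2; rw [← this]; simp
  have hconst := IsPreconnected.eq_or_eq_neg_of_sq_eq (isPreconnected_univ (α := ℝ))
    hgc.continuousOn (continuous_const (y := g 0)).continuousOn
    (by intro θ _; simp [hg2]) (by intro θ _; exact hgne 0)
  have h2π : g (2 * Real.pi) = - g 0 := by
    have e1 : γ (2 * Real.pi) = γ 0 := by
      simp only [hγ]; push_cast; rw [Complex.exp_two_pi_mul_I]; simp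
    simp only [hg, e1]
    push_cast
    have : -(2 * (Real.pi : ℂ) / 2) * Complex.I = -(Real.pi * Complex.I) := by ring
    rw [this, Complex.exp_neg, Complex.exp_pi_mul_I]
    simp
  rcases hconst with hh | hh
  · have := hh (Set.mem_univ (2 * Real.pi))
    rw [h2π] at this
    exact hgne 0 (self_eq_neg.1 this.symm)
  · have := hh (Set.mem_univ 0)
    exact hgne 0 (self_eq_neg.1 this)

/-- the Wermer type set -/
def EE (a : ℕ → ℂ) : Set (Fin 2 → ℂ) :=
  {x | ‖x 0‖ ≤ 1 ∧ ∃ s, Val a (x 0) s ∧ x 1 = full s}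

/-- the parameter set -/
def CC (a : ℕ → ℂ) : Set (ℂ × (ℕ → ℂ)) := {p | ‖p.1‖ ≤ 1 ∧ Val a p.1 p.2}

lemma CC_compact {a : ℕ → ℂ} (ha : ∀ j, ‖a j‖ ≤ 1) : IsCompact (CC a) := by
  have h1 : IsCompact ((closedBall (0 : ℂ) 1) ×ˢ
      (Set.univ.pi (fun j : ℕ => closedBall (0 : ℂ) (2 ^ (j + 1))))) :=
    (isCompact_closedBall _ _).prod (isCompact_univ_pi fun j => isCompact_closedBall _ _)
  apply h1.of_isClosed_subset
  · have e : CC a = {p | ‖p.1‖ ≤ 1} ∩ ⋂ j, {p : ℂ × (ℕ → ℂ) | p.2 j ^ 2 = QQ a j p.1} := by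
      ext p; simp [CC, Val]
    rw [e]
    apply (isClosed_le (by fun_prop) (by fun_prop)).inter
    apply isClosed_iInter
    intro j
    exact isClosed_eq (by fun_prop) ((QQ_cont a j).comp continuous_fst)
  · rintro ⟨z, s⟩ ⟨hz, hs⟩
    refine ⟨by simpa using hz, ?_⟩
    intro j _
    simpa using val_bound ha hz hs j

lemma cc_two (j : ℕ) : cc j * 2 ^ (j + 1) ≤ (1 / 8) ^ j := by
  induction j with
  | zero => simp [cc]; norm_num
  | succ j ih =>
    have := cc_succ j
    have h2 : (0 : ℝ) < 2 ^ (j + 1) := by positivity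
    have h3 : cc (j + 1) * 2 ^ (j + 1) ≤ cc j / 16 * 2 ^ (j + 1) := by gcongr
    rw [pow_succ (2 : ℝ) (j + 1), pow_succ (1 / 8 : ℝ)]
    linarith

lemma full_cont {a : ℕ → ℂ} (ha : ∀ j, ‖a j‖ ≤ 1) :
    ContinuousOn (fun p : ℂ × (ℕ → ℂ) => full p.2) (CC a) := by
  unfold full
  apply continuousOn_const.add
  apply continuousOn_tsum (u := fun j => (1 / 8 : ℝ) ^ j)
  · intro j; fun_prop
  · exact geo_sum.summable
  · rintro j ⟨z, s⟩ ⟨hz, hs⟩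
    rw [norm_mul, Complex.norm_real, Real.norm_of_nonneg (cc_pos j).le]
    refine le_trans ?_ (cc_two j)
    have := val_bound ha hz hs j
    have := cc_pos j
    gcongr

lemma part_cont (n : ℕ) : Continuous (fun p : ℂ × (ℕ → ℂ) => part n p.2) := by
  unfold part; fun_prop

lemma EE_compact {a : ℕ → ℂ} (ha : ∀ j, ‖a j‖ ≤ 1) : IsCompact (EE a) := by
  have : EE a = (fun p : ℂ × (ℕ → ℂ) => (![p.1, full p.2] : Fin 2 → ℂ)) '' CC a := by
    ext x
    constructor
    · rintro ⟨h, s, hs, hx⟩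
      refine ⟨(x 0, s), ⟨h, hs⟩, ?_⟩
      funext i; fin_cases i <;> simp [hx]
    · rintro ⟨⟨z, s⟩, ⟨hz, hs⟩, rfl⟩
      exact ⟨by simpa using hz, s, by simpa using hs, by simp⟩
  rw [this]
  apply (CC_compact ha).image_of_continuousOn
  apply continuousOn_pi.2
  intro i
  fin_cases i
  · exact continuousOn_fst
  · exact full_cont ha

lemma eval_diff (g : MvPolynomial (Fin 2) ℂ) {f0 f1 : ℂ → ℂ} {z : ℂ}
    (h0 : DifferentiableAt ℂ f0 z) (h1 : DifferentiableAt ℂ f1 z) :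
    DifferentiableAt ℂ (fun t => MvPolynomial.eval ![f0 t, f1 t] g) z := by
  induction g using MvPolynomial.induction_on with
  | C c => simp
  | add p q hp hq =>
    simp only [map_add]
    exact hp.add hq
  | mul_X p i hp =>
    simp only [map_mul, MvPolynomial.eval_X]
    apply hp.mul
    fin_cases i
    · simpa using h0
    · simpa using h1

lemma max_princ {a : ℕ → ℂ} (ha : ∀ j, ‖a j‖ ≤ 1) (n : ℕ) (g : MvPolynomial (Fin 2) ℂ) {m : ℝ}
    (hm : 0 ≤ m) {z0 : ℂ} {s0 : ℕ → ℂ} (hs0 : Val a z0 s0) (hz0 : ∀ j, z0 ≠ a j)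
    (hin : ‖z0‖ ^ 2 + ‖part n s0‖ ^ 2 ≤ 1)
    (hbd : ∀ z s, Val a z s → ‖z‖ ^ 2 + ‖part n s‖ ^ 2 = 1 →
      ‖MvPolynomial.eval ![z, part n s] g‖ ≤ m) :
    ‖MvPolynomial.eval ![z0, part n s0] g‖ ≤ m := by
  by_contra! hlt
  set D : ℂ → ℂ := fun z => ∏ j ∈ Finset.range n, (z - a j) with hD
  have hD0 : D z0 ≠ 0 := Finset.prod_ne_zero_iff.2 fun j _ => sub_ne_zero.2 (hz0 j)
  have hDb : ∀ z, ‖z‖ ≤ 1 → ‖D z‖ ≤ 2 ^ n := by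
    intro z hz
    simp only [hD, norm_prod]
    calc _ ≤ ∏ j ∈ Finset.range n, (2 : ℝ) :=
          Finset.prod_le_prod (fun _ _ => norm_nonneg _) (fun j _ => sub_le_two ha hz j)
      _ = 2 ^ n := by simp
  set G := ‖MvPolynomial.eval ![z0, part n s0] g‖ with hG
  have hG0 : 0 < G := lt_of_le_of_lt hm hlt
  obtain ⟨N, hN⟩ := exists_pow_lt_of_lt_one
    (show 0 < ‖D z0‖ / 2 ^ n from div_pos (norm_pos_iff.2 hD0) (by positivity))
    ((div_lt_one hG0).2 hlt)
  have hN' : m ^ N * 2 ^ n < G ^ N * ‖D z0‖ := by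
    rw [div_pow, div_lt_div_iff₀ (by positivity) (by positivity)] at hN
    linarith
  set h : ℂ × (ℕ → ℂ) → ℝ := fun p =>
    ‖MvPolynomial.eval ![p.1, part n p.2] g ^ N * D p.1‖ with hh
  have hhc : Continuous h := by
    have c1 : Continuous (fun p : ℂ × (ℕ → ℂ) => (![p.1, part n p.2] : Fin 2 → ℂ)) := by
      apply continuous_pi
      intro i; fin_cases i
      · exact continuous_fst
      · exact part_cont n
    have c2 : Continuous D := by simp only [hD]; fun_prop
    exact ((((cont_eval g).comp c1).pow N).mul (c2.comp continuous_fst)).norm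
  set A := {p ∈ CC a | ‖p.1‖ ^ 2 + ‖part n p.2‖ ^ 2 ≤ 1} with hA
  have hle1 : ∀ (z w : ℂ), ‖z‖ ^ 2 + ‖w‖ ^ 2 ≤ 1 → ‖z‖ ≤ 1 := by
    intro z w hzw
    nlinarith [norm_nonneg z, sq_nonneg ‖w‖]
  have hpc := part_cont n
  have hAc : IsCompact A := (CC_compact ha).inter_right
    (isClosed_le (f := fun p : ℂ × (ℕ → ℂ) => ‖p.1‖ ^ 2 + ‖part n p.2‖ ^ 2) (g := fun _ => 1)
      (by fun_prop) (by fun_prop))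
  have hp0 : (z0, s0) ∈ A := ⟨⟨hle1 _ _ hin, hs0⟩, hin⟩
  obtain ⟨q, hq, hqm⟩ := hAc.exists_isMaxOn ⟨_, hp0⟩ hhc.continuousOn
  set A' := {p ∈ A | h q ≤ h p} with hA'
  have hA'c : IsCompact A' := hAc.inter_right (isClosed_le continuous_const hhc)
  obtain ⟨⟨z1, s1⟩, ⟨hp1, hp1m⟩, hp1re⟩ := hA'c.exists_isMaxOn ⟨q, hq, le_rfl⟩
    (f := fun p : ℂ × (ℕ → ℂ) => p.1.re) (by fun_prop)
  have hmax : ∀ p ∈ A, h p ≤ h (z1, s1) := fun p hp => (hqm hp).trans hp1m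
  have hbig : G ^ N * ‖D z0‖ ≤ h (z1, s1) := by
    have := hmax _ hp0
    simpa [hh, hG] using this
  have hs1 : Val a z1 s1 := hp1.1.2
  have hz1 : ‖z1‖ ≤ 1 := hp1.1.1
  have hlt1 : ‖z1‖ ^ 2 + ‖part n s1‖ ^ 2 < 1 := by
    refine lt_of_le_of_ne hp1.2 fun heq => ?_
    have h1 := hbd z1 s1 hs1 heq
    have h2 : h (z1, s1) ≤ m ^ N * 2 ^ n := by
      simp only [hh, norm_mul, norm_pow]
      have := hDb z1 hz1
      gcongr
    linarith
  have hD1 : D z1 ≠ 0 := by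
    intro h0
    have : h (z1, s1) = 0 := by simp [hh, h0]
    have : 0 < G ^ N * ‖D z0‖ := mul_pos (by positivity) (norm_pos_iff.2 hD0)
    linarith
  have hQ1 : ∀ j < n, QQ a j z1 ≠ 0 := by
    intro j hj
    have h1 := Finset.prod_ne_zero_iff.1 hD1
    unfold QQ
    apply mul_ne_zero
    · apply pow_ne_zero
      exact Finset.prod_ne_zero_iff.2 fun i hi =>
        h1 i (Finset.mem_range.2 ((Finset.mem_range.1 hi).trans hj))
    · exact h1 j (Finset.mem_range.2 hj)
  choose r hr using fun z => val_exists a z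
  set σ : ℂ → ℕ → ℂ := fun z j =>
    if j < n then s1 j * (QQ a j z / QQ a j z1) ^ ((2 : ℕ) : ℂ)⁻¹ else r z j with hσ
  have hσv : ∀ z, Val a z (σ z) := by
    intro z j
    simp only [hσ]
    split_ifs with hj
    · rw [mul_pow, Complex.cpow_nat_inv_pow _ (by norm_num), hs1 j]
      field_simp [hQ1 j hj]
    · exact hr z j
  set W : ℂ → ℂ := fun z => -1 / 2 + ∑ j ∈ Finset.range n,
    (cc j : ℂ) * (s1 j * (QQ a j z / QQ a j z1) ^ ((2 : ℕ) : ℂ)⁻¹) with hW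
  have hWp : ∀ z, part n (σ z) = W z := by
    intro z
    simp only [part, hW, hσ]
    congr 1
    apply Finset.sum_congr rfl
    intro j hj
    rw [if_pos (Finset.mem_range.1 hj)]
  have hWz1 : W z1 = part n s1 := by
    simp only [part, hW]
    congr 1
    apply Finset.sum_congr rfl
    intro j hj
    rw [div_self (hQ1 j (Finset.mem_range.1 hj))]
    simp
  have hQd : ∀ j, Differentiable ℂ (QQ a j) := by
    intro j; unfold QQ; fun_prop
  have hWd : ∀ᶠ z in nhds z1, DifferentiableAt ℂ W z := by
    have : ∀ᶠ z in nhds z1, ∀ j ∈ Finset.range n, QQ a j z / QQ a j z1 ∈ Complex.slitPlane := by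
      rw [Filter.eventually_all_finset]
      intro j hj
      have hc : ContinuousAt (fun z => QQ a j z / QQ a j z1) z1 :=
        ((QQ_cont a j).div_const _).continuousAt
      apply hc.eventually_mem
      rw [div_self (hQ1 j (Finset.mem_range.1 hj))]
      exact Complex.isOpen_slitPlane.mem_nhds Complex.one_mem_slitPlane
    filter_upwards [this] with z hz
    apply DifferentiableAt.const_add
    apply DifferentiableAt.fun_sum
    intro j hj
    apply DifferentiableAt.const_mul
    apply DifferentiableAt.const_mul
    exact ((hQd j z).div_const _).cpow_const (hz j hj)
  set H : ℂ → ℂ := fun z => MvPolynomial.eval ![z, W z] g ^ N * D z with hH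
  have hHd : ∀ᶠ z in nhds z1, DifferentiableAt ℂ H z := by
    filter_upwards [hWd] with z hz
    apply DifferentiableAt.mul
    · exact (eval_diff g differentiableAt_id hz).pow N
    · simp only [hD]; fun_prop
  have hHh : ∀ z, ‖H z‖ = h (z, σ z) := by
    intro z; simp only [hH, hh, hWp]
  have hH1 : ‖H z1‖ = h (z1, s1) := by
    simp only [hH, hh, hWz1]
  have hin' : ∀ᶠ z in nhds z1, (z, σ z) ∈ A := by
    have hc : ContinuousAt (fun z => ‖z‖ ^ 2 + ‖W z‖ ^ 2) z1 := by
      have := hWd.self_of_nhds.continuousAt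
      fun_prop
    have : ∀ᶠ z in nhds z1, ‖z‖ ^ 2 + ‖W z‖ ^ 2 < 1 := by
      apply hc.eventually_lt_const
      show ‖z1‖ ^ 2 + ‖W z1‖ ^ 2 < 1; rw [hWz1]; exact hlt1
    filter_upwards [this] with z hz
    rw [← hWp] at hz
    exact ⟨⟨hle1 _ _ hz.le, hσv z⟩, hz.le⟩
  have hloc : IsLocalMax (norm ∘ H) z1 := by
    filter_upwards [hin'] with z hz
    simp only [Function.comp, hHh z, hH1]
    exact hmax _ hz
  have hconst := Complex.eventually_eq_of_isLocalMax_norm hHd hloc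
  obtain ⟨ε, hε, hball⟩ := Metric.eventually_nhds_iff.1 (hconst.and hin')
  set z2 : ℂ := z1 + ((ε / 2 : ℝ) : ℂ) with hz2
  have h2 := hball (y := z2) (by
    rw [hz2, dist_eq_norm, add_sub_cancel_left, Complex.norm_real,
      Real.norm_of_nonneg (by positivity)]
    linarith)
  have h3 : (z2, σ z2) ∈ A' := by
    refine ⟨h2.2, ?_⟩
    rw [← hHh, h2.1, hH1]
    exact hp1m
  have h4 : z2.re ≤ z1.re := hp1re h3
  rw [hz2, Complex.add_re, Complex.ofReal_re] at h4
  linarith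

/-- the compact set in the sphere -/
def XX (a : ℕ → ℂ) : Set (Fin 2 → ℂ) := EE a ∩ SphS3

lemma sph_closed : IsClosed SphS3 := by
  unfold SphS3
  exact isClosed_eq (by fun_prop) continuous_const

lemma sph_compact : IsCompact SphS3 := by
  apply (isCompact_closedBall (0 : Fin 2 → ℂ) 1).of_isClosed_subset sph_closed
  intro x hx
  have hx' : ‖x 0‖ ^ 2 + ‖x 1‖ ^ 2 = 1 := hx
  rw [mem_closedBall_zero_iff, pi_norm_le_iff_of_nonneg zero_le_one]
  intro i
  fin_cases i
  · simp only [Fin.zero_eta]; nlinarith [norm_nonneg (x 0), sq_nonneg ‖x 1‖]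
  · simp only [Fin.mk_one]; nlinarith [norm_nonneg (x 1), sq_nonneg ‖x 0‖]

lemma XX_compact {a : ℕ → ℂ} (ha : ∀ j, ‖a j‖ ≤ 1) : IsCompact (XX a) :=
  (EE_compact ha).inter_right sph_closed

lemma tail_unif {a : ℕ → ℂ} (ha : ∀ j, ‖a j‖ ≤ 1) {z : ℂ} (hz : ‖z‖ ≤ 1) {s : ℕ → ℂ}
    (hs : Val a z s) (n : ℕ) : ‖full s - part n s‖ ≤ 2 * (cc n * 2 ^ (n + 1)) := by
  refine (tail_le ha hz hs n).trans ?_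
  have := val_bound ha hz hs n
  have := cc_pos n
  gcongr

lemma part_near {a : ℕ → ℂ} (ha : ∀ j, ‖a j‖ ≤ 1) {z : ℂ} (hz : ‖z‖ ≤ 1) {s : ℕ → ℂ}
    (hs : Val a z s) (n : ℕ) : ‖part n s‖ ≤ 3 / 4 := by
  unfold part
  have h1 : ‖∑ j ∈ Finset.range n, (cc j : ℂ) * s j‖ ≤ 1 / 4 := by
    refine (norm_sum_le _ _).trans ?_
    refine le_trans (le_of_eq ?_) (sum_le ha hz hs n)
    apply Finset.sum_congr rfl
    intro j _
    rw [norm_mul, Complex.norm_real, Real.norm_of_nonneg (cc_pos j).le]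
  have h2 : ‖(-1 / 2 : ℂ)‖ = 1 / 2 := by norm_num
  have := norm_add_le (-1 / 2 : ℂ) (∑ j ∈ Finset.range n, (cc j : ℂ) * s j)
  linarith

lemma tail_tendsto : Filter.Tendsto (fun n => 2 * (cc n * 2 ^ (n + 1))) Filter.atTop (nhds 0) := by
  have h : Filter.Tendsto (fun n : ℕ => 2 * (1 / 8 : ℝ) ^ n) Filter.atTop (nhds 0) := by
    simpa using (tendsto_pow_atTop_nhds_zero_of_lt_one (r := (1 / 8 : ℝ)) (by norm_num)
      (by norm_num)).const_mul 2
  apply squeeze_zero _ _ h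
  · intro n; have := cc_pos n; positivity
  · intro n; have := cc_two n; linarith

lemma part_seq {a : ℕ → ℂ} (ha : ∀ j, ‖a j‖ ≤ 1) {z : ℕ → ℂ} {s : ℕ → ℕ → ℂ}
    (hz : ∀ n, ‖z n‖ ≤ 1) (hs : ∀ n, Val a (z n) (s n)) {k : ℕ → ℕ}
    (hk : Filter.Tendsto k Filter.atTop Filter.atTop) {w : ℂ}
    (hw : Filter.Tendsto (fun n => full (s n)) Filter.atTop (nhds w)) :
    Filter.Tendsto (fun n => part (k n) (s n)) Filter.atTop (nhds w) := by
  have h1 : Filter.Tendsto (fun n => full (s n) - part (k n) (s n)) Filter.atTop (nhds 0) := by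
    apply squeeze_zero_norm _ (tail_tendsto.comp hk)
    intro n
    exact tail_unif ha (hz n) (hs n) (k n)
  simpa using hw.sub h1

lemma vec_tendsto {α : Type*} {l : Filter α} {z w : α → ℂ} {z0 w0 : ℂ}
    (hz : Filter.Tendsto z l (nhds z0)) (hw : Filter.Tendsto w l (nhds w0)) :
    Filter.Tendsto (fun n => (![z n, w n] : Fin 2 → ℂ)) l (nhds ![z0, w0]) := by
  rw [tendsto_pi_nhds]
  intro i
  fin_cases i
  · simpa using hz
  · simpa using hw

lemma in_hull {a : ℕ → ℂ} (ha : ∀ j, ‖a j‖ ≤ 1) {z0 : ℂ} {s0 : ℕ → ℂ} (hs0 : Val a z0 s0)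
    (hz0 : ∀ j, z0 ≠ a j) (hz1 : ‖z0‖ ≤ 1 / 2) : ![z0, full s0] ∈ polyHull (XX a) := by
  intro p
  set M := sSup ((fun w => ‖MvPolynomial.eval w p‖) '' XX a) with hM
  have hM0 : 0 ≤ M := Real.sSup_nonneg (by rintro _ ⟨w, _, rfl⟩; positivity)
  by_contra! hlt
  obtain ⟨m, hMm, hmp⟩ := exists_between hlt
  have hz1' : ‖z0‖ ≤ 1 := by linarith
  have hpart : Filter.Tendsto (fun n => part n s0) Filter.atTop (nhds (full s0)) :=
    part_seq ha (z := fun _ => z0) (s := fun _ => s0) (fun _ => hz1') (fun _ => hs0)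
      Filter.tendsto_id tendsto_const_nhds
  have hev : ∀ᶠ n in Filter.atTop, m < ‖MvPolynomial.eval ![z0, part n s0] p‖ := by
    have := ((cont_eval p).tendsto _).comp (vec_tendsto (tendsto_const_nhds (x := z0)) hpart)
    exact this.norm.eventually_const_lt hmp
  obtain ⟨N, hN⟩ := Filter.eventually_atTop.1 hev
  have hex : ∀ k : ℕ, ∃ q ∈ CC a, ‖q.1‖ ^ 2 + ‖part (N + k) q.2‖ ^ 2 = 1 ∧
      m < ‖MvPolynomial.eval ![q.1, part (N + k) q.2] p‖ := by
    intro k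
    by_contra! hc
    have := max_princ ha (N + k) p (m := m) (by linarith) hs0 hz0 (by
      have := part_near ha hz1' hs0 (N + k)
      have h1 : ‖part (N + k) s0‖ ^ 2 ≤ (3 / 4) ^ 2 := pow_le_pow_left₀ (norm_nonneg _) this 2
      have h2 : ‖z0‖ ^ 2 ≤ (1 / 2) ^ 2 := pow_le_pow_left₀ (norm_nonneg _) hz1 2
      linarith) (by
      intro z s hs hzs
      refine hc (z, s) ⟨?_, hs⟩ hzs
      show ‖z‖ ≤ 1
      nlinarith [norm_nonneg z, sq_nonneg ‖part (N + k) s‖])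
    have h2 := hN (N + k) (by omega)
    linarith
  choose q hqC hq1 hqm using hex
  obtain ⟨q0, hq0, φ, hφ, hlim⟩ := (CC_compact ha).tendsto_subseq hqC
  have hfull : Filter.Tendsto (fun n => full (q (φ n)).2) Filter.atTop (nhds (full q0.2)) := by
    have h1 := full_cont ha q0 hq0
    have h2 : Filter.Tendsto (q ∘ φ) Filter.atTop (nhdsWithin q0 (CC a)) :=
      tendsto_nhdsWithin_iff.2 ⟨hlim, Filter.Eventually.of_forall fun n => hqC _⟩
    exact h1.tendsto.comp h2
  have hz : Filter.Tendsto (fun n => (q (φ n)).1) Filter.atTop (nhds q0.1) :=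
    (continuous_fst.tendsto q0).comp hlim
  have hw : Filter.Tendsto (fun n => part (N + φ n) (q (φ n)).2) Filter.atTop
      (nhds (full q0.2)) := by
    apply part_seq ha (z := fun n => (q (φ n)).1) (s := fun n => (q (φ n)).2)
      (fun n => (hqC _).1) (fun n => (hqC _).2) (k := fun n => N + φ n) _ hfull
    exact Filter.tendsto_atTop_mono (fun n => Nat.le_add_left _ _) hφ.tendsto_atTop
  have hsph : ‖q0.1‖ ^ 2 + ‖full q0.2‖ ^ 2 = 1 := by
    have h1 := (hz.norm.pow 2).add (hw.norm.pow 2)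
    have h2 : (fun n => ‖(q (φ n)).1‖ ^ 2 + ‖part (N + φ n) (q (φ n)).2‖ ^ 2) = fun _ => 1 := by
      funext n; exact hq1 _
    rw [h2] at h1
    exact tendsto_nhds_unique h1 tendsto_const_nhds |>.symm ▸ rfl
  have hX : ![q0.1, full q0.2] ∈ XX a := by
    refine ⟨⟨by simpa using hq0.1, q0.2, by simpa using hq0.2, by simp⟩, ?_⟩
    simpa [SphS3] using hsph
  have h1 : ‖MvPolynomial.eval ![q0.1, full q0.2] p‖ ≤ M :=
    le_csSup (bdd_eval (XX_compact ha) p) ⟨_, hX, rfl⟩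
  have h2 : m ≤ ‖MvPolynomial.eval ![q0.1, full q0.2] p‖ := by
    have := (((cont_eval p).tendsto _).comp (vec_tendsto hz hw)).norm
    exact ge_of_tendsto' this fun n => (hqm _).le
  linarith

lemma even_poly (q : MvPolynomial (Fin 2) ℂ) (c : ℂ) (P : MvPolynomial (Fin 2) ℂ) :
    ∃ A B : MvPolynomial (Fin 2) ℂ, ∀ z w σ : ℂ, σ ^ 2 = MvPolynomial.eval ![z, w] q →
      MvPolynomial.eval ![z, w + c * σ] P =
        MvPolynomial.eval ![z, w] A + σ * MvPolynomial.eval ![z, w] B := by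
  induction P using MvPolynomial.induction_on with
  | C d => exact ⟨MvPolynomial.C d, 0, by intros; simp⟩
  | add P Q hP hQ =>
    obtain ⟨A, B, h⟩ := hP
    obtain ⟨A', B', h'⟩ := hQ
    refine ⟨A + A', B + B', fun z w σ hσ => ?_⟩
    simp only [map_add, h z w σ hσ, h' z w σ hσ]; ring
  | mul_X P i hP =>
    obtain ⟨A, B, h⟩ := hP
    fin_cases i
    · refine ⟨A * MvPolynomial.X 0, B * MvPolynomial.X 0, fun z w σ hσ => ?_⟩
      simp [h z w σ hσ]; ring
    · refine ⟨A * MvPolynomial.X 1 + MvPolynomial.C c * B * q,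
        MvPolynomial.C c * A + B * MvPolynomial.X 1, fun z w σ hσ => ?_⟩
      simp [h z w σ hσ, ← hσ]; ring

lemma QQ_poly (a : ℕ → ℂ) (j : ℕ) : ∃ q : MvPolynomial (Fin 2) ℂ, ∀ z w : ℂ,
    MvPolynomial.eval ![z, w] q = QQ a j z := by
  refine ⟨(∏ i ∈ Finset.range j, (MvPolynomial.X 0 - MvPolynomial.C (a i))) ^ 2 *
    (MvPolynomial.X 0 - MvPolynomial.C (a j)), fun z w => ?_⟩
  simp [QQ, map_prod]

lemma val_update {a : ℕ → ℂ} {z : ℂ} {s : ℕ → ℂ} (hs : Val a z s) {n : ℕ} {x : ℂ}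
    (hx : x ^ 2 = QQ a n z) : Val a z (Function.update s n x) := by
  intro j
  by_cases h : j = n
  · subst h; simpa using hx
  · simpa [h] using hs j

lemma part_update (s : ℕ → ℂ) (n : ℕ) (x : ℂ) :
    part (n + 1) (Function.update s n x) = part n s + cc n * x := by
  unfold part
  rw [Finset.sum_range_succ, Function.update_self, ← add_assoc]
  congr 2
  apply Finset.sum_congr rfl
  intro j hj
  rw [Function.update_of_ne (Finset.mem_range.1 hj).ne]

lemma PP_exists (a : ℕ → ℂ) (n : ℕ) : ∃ P : MvPolynomial (Fin 2) ℂ,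
    (∀ z w, ∃ s, Val a z s ∧ ‖w - part n s‖ ^ (2 ^ n) ≤ ‖MvPolynomial.eval ![z, w] P‖) ∧
    (∀ z w s, Val a z s → ‖w + 1 / 2‖ + ∑ j ∈ Finset.range n, cc j * ‖s j‖ ≤ 1 →
      ‖MvPolynomial.eval ![z, w] P‖ ≤ ‖w - part n s‖) := by
  induction n with
  | zero =>
    have e : ∀ (w : ℂ) s, w - part 0 s = w + 1 / 2 := by intro w s; simp [part]; ring
    refine ⟨MvPolynomial.X 1 + MvPolynomial.C (1 / 2), ?_, ?_⟩
    · intro z w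
      obtain ⟨s, hs⟩ := val_exists a z
      refine ⟨s, hs, ?_⟩
      rw [e]; simp
    · intro z w s hs _
      rw [e]; simp
  | succ n ih =>
    obtain ⟨P, hP1, hP2⟩ := ih
    obtain ⟨q, hq⟩ := QQ_poly a n
    obtain ⟨A, B, hAB⟩ := even_poly q (cc n) P
    have hR : ∀ z w σ : ℂ, σ ^ 2 = QQ a n z →
        MvPolynomial.eval ![z, w] (A ^ 2 - q * B ^ 2) =
          MvPolynomial.eval ![z, w - cc n * σ] P * MvPolynomial.eval ![z, w + cc n * σ] P := by
      intro z w σ hσ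
      have h1 := hAB z w σ (by rw [hq, hσ])
      have h2 := hAB z w (-σ) (by rw [hq, ← hσ]; ring)
      have e : w - cc n * σ = w + cc n * (-σ) := by ring
      rw [e, h1, h2]
      simp only [map_sub, map_mul, map_pow, hq, ← hσ]
      ring
    refine ⟨A ^ 2 - q * B ^ 2, ?_, ?_⟩
    · intro z w
      obtain ⟨t, ht⟩ := val_exists a z
      have hσ := ht n
      set σ := t n
      rw [hR z w σ hσ, norm_mul]
      obtain ⟨s, hs, h1⟩ := hP1 z (w - cc n * σ)
      obtain ⟨s', hs', h2⟩ := hP1 z (w + cc n * σ)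
      have e1 : w - cc n * σ - part n s = w - part (n + 1) (Function.update s n σ) := by
        rw [part_update]; ring
      have e2 : w + cc n * σ - part n s' = w - part (n + 1) (Function.update s' n (-σ)) := by
        rw [part_update]; ring
      rw [e1] at h1
      rw [e2] at h2
      have h3 := mul_le_mul h1 h2 (by positivity) (norm_nonneg _)
      have hpp : ∀ x : ℝ, x ^ 2 ^ (n + 1) = x ^ 2 ^ n * x ^ 2 ^ n := by
        intro x; rw [← pow_add]; congr 1; ring
      rcases le_total ‖w - part (n + 1) (Function.update s n σ)‖
        ‖w - part (n + 1) (Function.update s' n (-σ))‖ with h4 | h4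
      · refine ⟨_, val_update hs hσ, le_trans ?_ h3⟩
        rw [hpp]
        gcongr
      · refine ⟨_, val_update hs' (x := -σ) (by rw [← hσ]; ring), le_trans ?_ h3⟩
        rw [hpp]
        gcongr
    · intro z w s hs hle
      rw [hR z w (s n) (hs n), norm_mul]
      rw [Finset.sum_range_succ] at hle
      have hn : ‖(cc n : ℂ) * s n‖ = cc n * ‖s n‖ := by
        rw [norm_mul, Complex.norm_real, Real.norm_of_nonneg (cc_pos n).le]
      have b1 : ‖w - cc n * s n + 1 / 2‖ ≤ ‖w + 1 / 2‖ + cc n * ‖s n‖ := by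
        have e : w - cc n * s n + 1 / 2 = (w + 1 / 2) - cc n * s n := by ring
        rw [e, ← hn]; exact norm_sub_le _ _
      have b2 : ‖w + cc n * s n + 1 / 2‖ ≤ ‖w + 1 / 2‖ + cc n * ‖s n‖ := by
        have e : w + cc n * s n + 1 / 2 = (w + 1 / 2) + cc n * s n := by ring
        rw [e, ← hn]; exact norm_add_le _ _
      have c1 := hP2 z (w - cc n * s n) s hs (by linarith)
      have c2 := hP2 z (w + cc n * s n) s hs (by linarith)
      have e1 : w - cc n * s n - part n s = w - part (n + 1) s := by
        unfold part; rw [Finset.sum_range_succ]; ring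
      rw [e1] at c1
      have c3 : ‖w + cc n * s n - part n s‖ ≤ 1 := by
        have e : w + cc n * s n - part n s =
            (w + cc n * s n + 1 / 2) - ∑ j ∈ Finset.range n, (cc j : ℂ) * s j := by
          unfold part; ring
        rw [e]
        have h5 : ‖∑ j ∈ Finset.range n, (cc j : ℂ) * s j‖ ≤
            ∑ j ∈ Finset.range n, cc j * ‖s j‖ := by
          refine (norm_sum_le _ _).trans (le_of_eq ?_)
          apply Finset.sum_congr rfl
          intro j _
          rw [norm_mul, Complex.norm_real, Real.norm_of_nonneg (cc_pos j).le]
        have := norm_sub_le (w + cc n * s n + 1 / 2) (∑ j ∈ Finset.range n, (cc j : ℂ) * s j)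
        linarith
      calc _ ≤ ‖w - part (n + 1) s‖ * 1 := by
            gcongr
            exact c2.trans c3
        _ = _ := mul_one _

lemma tau_le (n : ℕ) : 2 * (cc n * 2 ^ (n + 1)) ≤ (16 * (1 / 16 : ℝ) ^ (2 ^ n)) ^ (2 ^ n) := by
  have e : (4 : ℕ) ^ n = 2 ^ n * 2 ^ n := by rw [← mul_pow]; norm_num
  have h1 : (2 : ℝ) ^ (n + 2) ≤ 16 ^ (2 ^ n) := by
    have h2 : n + 2 ≤ 4 * 2 ^ n := by
      have := Nat.lt_two_pow_self (n := n)
      omega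
    calc (2 : ℝ) ^ (n + 2) ≤ 2 ^ (4 * 2 ^ n) := pow_le_pow_right₀ (by norm_num) h2
      _ = 16 ^ (2 ^ n) := by rw [pow_mul]; norm_num
  rw [mul_pow, ← pow_mul, ← e]
  unfold cc
  have h3 : (0 : ℝ) < (1 / 16) ^ 4 ^ n := by positivity
  calc 2 * ((1 / 16 : ℝ) ^ 4 ^ n * 2 ^ (n + 1)) = 2 ^ (n + 2) * (1 / 16) ^ 4 ^ n := by ring
    _ ≤ _ := by gcongr

lemma hull_sub {a : ℕ → ℂ} (ha : ∀ j, ‖a j‖ ≤ 1) : polyHull (XX a) ⊆ EE a := by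
  intro x hx
  have hx0 : ‖x 0‖ ≤ 1 := by
    simpa using hull_le hx (MvPolynomial.X 0) zero_le_one (by
      intro w hw; simpa using hw.1.1)
  have hxe : x = ![x 0, x 1] := by funext i; fin_cases i <;> rfl
  have hex : ∀ n : ℕ, ∃ s, Val a (x 0) s ∧ ‖x 1 - part n s‖ ≤ 16 * (1 / 16 : ℝ) ^ (2 ^ n) := by
    intro n
    obtain ⟨P, hP1, hP2⟩ := PP_exists a n
    have hb := hull_le hx P (M := 2 * (cc n * 2 ^ (n + 1)))
      (by have := cc_pos n; positivity) (by
        rintro w ⟨⟨hw0, s, hs, hw1⟩, -⟩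
        have hwe : w = ![w 0, w 1] := by funext i; fin_cases i <;> rfl
        rw [hwe]
        refine (hP2 _ _ s hs ?_).trans ?_
        · rw [hw1]
          have h1 := full_near ha hw0 hs
          have h2 := sum_le ha hw0 hs n
          linarith
        · rw [hw1]; exact tail_unif ha hw0 hs n)
    rw [hxe] at hb
    obtain ⟨s, hs, h1⟩ := hP1 (x 0) (x 1)
    refine ⟨s, hs, ?_⟩
    have h2 := (h1.trans hb).trans (tau_le n)
    exact (pow_le_pow_iff_left₀ (norm_nonneg _) (by positivity) (by positivity)).1 h2
  choose s hs hsn using hex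
  have hlim1 : Filter.Tendsto (fun n => x 1 - part n (s n)) Filter.atTop (nhds 0) := by
    apply squeeze_zero_norm hsn
    have h1 : Filter.Tendsto (fun n : ℕ => (2 : ℕ) ^ n) Filter.atTop Filter.atTop :=
      tendsto_pow_atTop_atTop_of_one_lt (by norm_num)
    have h2 := (tendsto_pow_atTop_nhds_zero_of_lt_one (r := (1 / 16 : ℝ)) (by norm_num)
      (by norm_num)).comp h1
    simpa [Function.comp_def] using h2.const_mul 16
  have hlim2 : Filter.Tendsto (fun n => full (s n) - part n (s n)) Filter.atTop (nhds 0) :=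
    squeeze_zero_norm (fun n => tail_unif ha hx0 (hs n) n) tail_tendsto
  have hlim3 : Filter.Tendsto (fun n => full (s n)) Filter.atTop (nhds (x 1)) := by
    have := (hlim2.sub hlim1).add_const (x 1)
    simpa using this
  have hlim4 := vec_tendsto (tendsto_const_nhds (x := x 0)) hlim3
  rw [hxe]
  apply (EE_compact ha).isClosed.mem_of_tendsto hlim4
  apply Filter.Eventually.of_forall
  intro n
  exact ⟨by simpa using hx0, s n, by simpa using hs n, by simp⟩

lemma loc_inv {f : ℂ → ℂ} (hf : DifferentiableOn ℂ f (ball (0:ℂ) 1)) {t0 : ℂ}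
    (ht : t0 ∈ ball (0:ℂ) 1) (hd : deriv f t0 ≠ 0) :
    ∃ r > 0, ∃ g : ℂ → ℂ, ContinuousOn g (ball (f t0) r) ∧
      ∀ z ∈ ball (f t0) r, g z ∈ ball (0:ℂ) 1 ∧ f (g z) = z := by
  have han : AnalyticAt ℂ f t0 := hf.analyticAt (isOpen_ball.mem_nhds ht)
  have hs : HasStrictDerivAt f (deriv f t0) t0 := han.hasStrictDerivAt
  have hs' := hs.hasStrictFDerivAt_equiv hd
  set e := hs'.toOpenPartialHomeomorph f with he
  have hcoe : (e : ℂ → ℂ) = f := hs'.toOpenPartialHomeomorph_coe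
  have hsrc : t0 ∈ e.source := hs'.mem_toOpenPartialHomeomorph_source
  have htgt : f t0 ∈ e.target := hs'.image_mem_toOpenPartialHomeomorph_target
  have hsy : e.symm (f t0) = t0 := by
    have := e.left_inv hsrc
    rwa [hcoe] at this
  have hc : ContinuousAt e.symm (f t0) := e.symm.continuousAt htgt
  have h1 : ∀ᶠ z in nhds (f t0), e.symm z ∈ ball (0:ℂ) 1 :=
    hc.eventually_mem (by rw [hsy]; exact isOpen_ball.mem_nhds ht)
  have h2 : ∀ᶠ z in nhds (f t0), z ∈ e.target := e.open_target.mem_nhds htgt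
  obtain ⟨r, hr, hb⟩ := Metric.eventually_nhds_iff_ball.1 (h1.and h2)
  refine ⟨r, hr, e.symm, ?_, ?_⟩
  · exact e.symm.continuousOn.mono fun z hz => (hb z hz).2
  · intro z hz
    refine ⟨(hb z hz).1, ?_⟩
    have := e.right_inv (hb z hz).2
    rwa [hcoe] at this

lemma EE_no_disc {a : ℕ → ℂ} (ha : ∀ j, ‖a j‖ ≤ 1)
    (hd : ∀ x : ℂ, ‖x‖ ≤ 1 → ∀ ε > 0, ∃ n, ‖a n - x‖ < ε)
    {f g : ℂ → ℂ} (hf : DifferentiableOn ℂ f (ball (0:ℂ) 1)) (hg : ContinuousOn g (ball (0:ℂ) 1))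
    (h : ∀ z ∈ ball (0:ℂ) 1, ![f z, g z] ∈ EE a) :
    ∀ z ∈ ball (0:ℂ) 1, ∀ w ∈ ball (0:ℂ) 1, f z = f w ∧ g z = g w := by
  have h' : ∀ t : ball (0:ℂ) 1, ‖f t‖ ≤ 1 ∧ ∃ s, Val a (f t) s ∧ g t = full s := by
    intro t
    simpa [EE] using h t t.2
  choose s hs hgs using fun t => (h' t).2
  have hfc : Continuous (fun t : ball (0:ℂ) 1 => f t) := hf.continuousOn.domRestrict
  have hgc : Continuous (fun t : ball (0:ℂ) 1 => g t) := hg.domRestrict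
  have hsc : ∀ n, Continuous (fun t => s t n) :=
    s_cont ha hfc hgc (fun t => (h' t).1) hs hgs
  by_cases hcon : ∀ z ∈ ball (0:ℂ) 1, ∀ w ∈ ball (0:ℂ) 1, f z = f w
  · intro z hz w hw
    refine ⟨hcon z hz w hw, ?_⟩
    have e : s ⟨z, hz⟩ = s ⟨w, hw⟩ := by
      funext n
      have hq : ∀ t, s t n ^ 2 = s ⟨w, hw⟩ n ^ 2 := by
        intro t
        rw [hs, hs, hcon t t.2 w hw]
      by_cases h0 : s ⟨w, hw⟩ n = 0
      · have := hq ⟨z, hz⟩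
        rw [h0] at this ⊢
        simpa using this
      · have hpc : IsPreconnected (Set.univ : Set (ball (0:ℂ) 1)) := by
          have : PreconnectedSpace (ball (0:ℂ) 1) :=
            Subtype.preconnectedSpace (convex_ball (0:ℂ) 1).isPreconnected
          exact isPreconnected_univ
        rcases hpc.eq_or_eq_neg_of_sq_eq (f := fun t => s t n) (g := fun _ => s ⟨w, hw⟩ n)
          (hsc n).continuousOn continuousOn_const (fun t _ => by simpa using hq t)
          (fun _ => h0) with h1 | h1
        · exact h1 (Set.mem_univ _)
        · have h2 := h1 (Set.mem_univ ⟨w, hw⟩)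
          have h3 := h1 (Set.mem_univ ⟨z, hz⟩)
          simp only [Pi.neg_apply] at h2 h3
          rw [h3, ← h2]
    have h1 := hgs ⟨z, hz⟩
    have h2 := hgs ⟨w, hw⟩
    simp only at h1 h2
    rw [h1, h2, e]
  · exfalso
    have : ∃ t0 ∈ ball (0:ℂ) 1, deriv f t0 ≠ 0 := by
      by_contra! hz
      apply hcon
      intro z hz1 w hw1
      exact isOpen_ball.is_const_of_deriv_eq_zero (convex_ball (0:ℂ) 1).isPreconnected hf
        (fun x hx => hz x hx) hz1 hw1
    obtain ⟨t0, ht0, hd0⟩ := this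
    obtain ⟨r, hr, k, hk, hkb⟩ := loc_inv hf ht0 hd0
    have hex : ∃ n, a n ∈ ball (f t0) r := by
      obtain ⟨n, hn⟩ := hd (f t0) (h' ⟨t0, ht0⟩).1 r hr
      exact ⟨n, by simpa [dist_eq_norm] using hn⟩
    classical
    set n := Nat.find hex with hn
    have hn1 : a n ∈ ball (f t0) r := Nat.find_spec hex
    have hn2 : ∀ i < n, a i ∉ ball (f t0) r := fun i hi => Nat.find_min hex hi
    obtain ⟨δ, hδ, hsub⟩ := Metric.isOpen_iff.1 isOpen_ball _ hn1
    let K : ball (a n) δ → ball (0:ℂ) 1 := fun z => ⟨k z, (hkb z (hsub z.2)).1⟩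
    have hK : Continuous K := ((hk.mono hsub).domRestrict).subtype_mk _
    let σ : ℂ → ℂ := fun z => if hz : z ∈ ball (a n) δ then
      s (K ⟨z, hz⟩) n / ∏ i ∈ Finset.range n, (z - a i) else 0
    have hp : ∀ z ∈ ball (a n) δ, ∏ i ∈ Finset.range n, (z - a i) ≠ 0 := by
      intro z hz
      rw [Finset.prod_ne_zero_iff]
      intro i hi h0
      apply hn2 i (Finset.mem_range.1 hi)
      rw [← sub_eq_zero.1 h0]
      exact hsub hz
    apply no_sqrt (σ := σ) hδ
    · rw [continuousOn_iff_continuous_domRestrict]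
      have e : (ball (a n) δ).domRestrict σ = fun z : ball (a n) δ =>
          s (K z) n / ∏ i ∈ Finset.range n, ((z : ℂ) - a i) := by
        funext z
        have : σ z = _ := dif_pos z.2
        simpa using this
      rw [e]
      apply Continuous.div ((hsc n).comp hK)
      · fun_prop
      · intro z; exact hp z z.2
    · intro z hz
      have e : σ z = s (K ⟨z, hz⟩) n / ∏ i ∈ Finset.range n, (z - a i) := dif_pos hz
      rw [e, div_pow, hs, div_eq_iff (pow_ne_zero _ (hp z hz))]
      have : f (K ⟨z, hz⟩) = z := (hkb z (hsub hz)).2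
      rw [this]; unfold QQ; ring

lemma exists_a : ∃ a : ℕ → ℂ, (∀ j, ‖a j‖ ≤ 1) ∧
    (∀ x : ℂ, ‖x‖ ≤ 1 → ∀ ε > 0, ∃ n, ‖a n - x‖ < ε) ∧ ∃ z0 : ℂ, ‖z0‖ ≤ 1 / 2 ∧ ∀ j, z0 ≠ a j := by
  have : Nonempty (closedBall (0:ℂ) 1) := ⟨⟨0, by simp⟩⟩
  let a : ℕ → ℂ := fun n => (TopologicalSpace.denseSeq (closedBall (0:ℂ) 1) n : ℂ)
  refine ⟨a, ?_, ?_, ?_⟩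
  · intro j
    exact mem_closedBall_zero_iff.1 (TopologicalSpace.denseSeq (closedBall (0:ℂ) 1) j).2
  · intro x hx ε hε
    obtain ⟨n, hn⟩ := (TopologicalSpace.denseRange_denseSeq (closedBall (0:ℂ) 1)).exists_dist_lt
      ⟨x, by simpa using hx⟩ hε
    refine ⟨n, ?_⟩
    rw [dist_comm, Subtype.dist_eq, dist_eq_norm] at hn
    exact hn
  · have hc : (Set.range a).Countable := Set.countable_range a
    have hd : Dense (Set.range a)ᶜ := hc.dense_compl ℝ
    obtain ⟨z0, hz, hz'⟩ := hd.exists_mem_open isOpen_ball (⟨0, by simp⟩ : (ball (0:ℂ) (1/2)).Nonempty)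
    refine ⟨z0, by simpa using (ball_subset_closedBall hz'), ?_⟩
    intro j e
    exact hz ⟨j, e.symm⟩

lemma im_const {f : ℂ → ℂ} (hf : DifferentiableOn ℂ f (ball (0:ℂ) 1)) {c : ℝ}
    (h : ∀ z ∈ ball (0:ℂ) 1, (f z).im = c) : ∃ b, ∀ z ∈ ball (0:ℂ) 1, f z = b :=
  (hf.analyticOnNhd isOpen_ball).eq_const_of_im_eq_const h isOpen_ball
    ⟨⟨0, by simp⟩, (convex_ball (0:ℂ) 1).isPreconnected⟩

lemma norm_const {f : ℂ → ℂ} (hf : DifferentiableOn ℂ f (ball (0:ℂ) 1)) {c : ℝ}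
    (h : ∀ z ∈ ball (0:ℂ) 1, ‖f z‖ = c) : ∃ b, ∀ z ∈ ball (0:ℂ) 1, f z = b := by
  refine ⟨f 0, ?_⟩
  have h0 : (0:ℂ) ∈ ball (0:ℂ) 1 := by simp
  exact Complex.eqOn_of_isPreconnected_of_isMaxOn_norm (convex_ball (0:ℂ) 1).isPreconnected
    isOpen_ball hf h0 (fun z hz => by simp [h z hz, h 0 h0])

lemma exists_rho {a : ℕ → ℂ} (ha : ∀ j, ‖a j‖ ≤ 1) : ∃ ρ : (Fin 2 → ℂ) → ℝ,
    ContDiff ℝ (⊤ : ℕ∞) ρ ∧ (∀ x, x ∈ XX a ↔ ρ x = 0) ∧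
    (∀ x, x ∈ {x | x ∈ SphS3 ∧ (x 1).im = 0 ∧ 0 ≤ (x 1).re} ↔ ρ x = 1) := by
  have hY : IsClosed {x : Fin 2 → ℂ | x ∈ SphS3 ∧ (x 1).im = 0 ∧ 0 ≤ (x 1).re} := by
    apply sph_closed.inter
    have c1 : Continuous (fun x : Fin 2 → ℂ => (x 1).im) := by fun_prop
    have c2 : Continuous (fun x : Fin 2 → ℂ => (x 1).re) := by fun_prop
    exact (isClosed_eq c1 continuous_const).inter (isClosed_le continuous_const c2)
  have hD : Disjoint (XX a) {x : Fin 2 → ℂ | x ∈ SphS3 ∧ (x 1).im = 0 ∧ 0 ≤ (x 1).re} := by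
    rw [Set.disjoint_left]
    rintro x ⟨⟨hx, s, hs, e⟩, -⟩ ⟨-, -, h⟩
    have h1 := full_near ha hx hs
    have h2 := (Complex.abs_re_le_norm (full s + 1 / 2)).trans h1
    rw [← e] at h2
    have := (abs_le.1 h2).2
    norm_num at this
    linarith
  obtain ⟨ρ, h1, -, h2, h3⟩ := exists_contMDiff_zero_iff_one_iff_of_isClosed
    (n := (⊤ : ℕ∞)) (modelWithCornersSelf ℝ (Fin 2 → ℂ)) (XX_compact ha).isClosed hY hD
  exact ⟨ρ, contMDiff_iff_contDiff.1 h1, h2, h3⟩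

lemma graph_compact {f₁ f₂ : (Fin 2 → ℂ) → ℝ} (h1 : Continuous f₁) (h2 : Continuous f₂) :
    IsCompact (graphR2 f₁ f₂ SphS3) := by
  apply sph_compact.image
  apply continuous_pi
  intro i
  refine Fin.addCases (fun j => ?_) (fun j => ?_) i
  · simp only [Fin.append_left]; fun_prop
  · simp only [Fin.append_right]
    fin_cases j
    · simp; fun_prop
    · simp; fun_prop

lemma hull_mono {m : ℕ} {K L : Set (Fin m → ℂ)} (hL : IsCompact L) (h : K ⊆ L) :
    polyHull K ⊆ polyHull L := by
  intro z hz p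
  have hb := bdd_eval hL p
  refine hull_le hz p (Real.sSup_nonneg ?_) ?_
  · rintro _ ⟨w, -, rfl⟩; exact norm_nonneg _
  · intro w hw
    exact le_csSup hb ⟨w, h hw, rfl⟩

lemma sub_hull {m : ℕ} {K : Set (Fin m → ℂ)} (hK : IsCompact K) : K ⊆ polyHull K := by
  intro z hz p
  exact le_csSup (bdd_eval hK p) ⟨z, hz, rfl⟩

lemma hull_embed {K : Set (Fin 2 → ℂ)} {z : Fin 2 → ℂ} (hz : z ∈ polyHull K) :
    (Fin.append z ![(0:ℂ), 0] : Fin (2 + 2) → ℂ) ∈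
      polyHull ((fun w => (Fin.append w ![(0:ℂ), 0] : Fin (2 + 2) → ℂ)) '' K) := by
  intro p
  let q : MvPolynomial (Fin 2) ℂ := MvPolynomial.bind₁
    (Fin.append (fun i : Fin 2 => (MvPolynomial.X i : MvPolynomial (Fin 2) ℂ))
      (fun _ : Fin 2 => 0)) p
  have e : ∀ w : Fin 2 → ℂ, MvPolynomial.eval w q =
      MvPolynomial.eval (Fin.append w ![(0:ℂ), 0] : Fin (2 + 2) → ℂ) p := by
    intro w
    simp only [q]
    rw [← MvPolynomial.coe_aeval_eq_eval, ← MvPolynomial.coe_aeval_eq_eval]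
    simp only [RingHom.coe_coe]
    rw [MvPolynomial.aeval_bind₁]
    congr 2
    funext i
    refine Fin.addCases (fun j => ?_) (fun j => ?_) i
    · simp
    · rw [Fin.append_right, Fin.append_right]
      fin_cases j <;> simp
  have := hz q
  rw [Set.image_image]
  simpa only [e] using this

lemma fiber_case {ρ : (Fin 2 → ℂ) → ℝ} (hρ : Continuous ρ)
    (h1 : ∀ x, x ∈ {x | x ∈ SphS3 ∧ (x 1).im = 0 ∧ 0 ≤ (x 1).re} ↔ ρ x = 1)
    {u c : ℝ} {f g : ℂ → ℂ} (hf : DifferentiableOn ℂ f (ball (0:ℂ) 1))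
    (hg : DifferentiableOn ℂ g (ball (0:ℂ) 1))
    (h : ∀ z ∈ ball (0:ℂ) 1, ![f z, g z] ∈ polyHull {x | x ∈ SphS3 ∧ ρ x = u ∧ (x 0).re = c}) :
    ∀ z ∈ ball (0:ℂ) 1, ∀ w ∈ ball (0:ℂ) 1, f z = f w ∧ g z = g w := by
  set L := {x | x ∈ SphS3 ∧ ρ x = u ∧ (x 0).re = c} with hL
  have hLc : IsCompact L := by
    apply sph_compact.inter_right
    exact (isClosed_eq (by fun_prop) (by fun_prop)).inter (isClosed_eq (by fun_prop) (by fun_prop))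
  let q : MvPolynomial (Fin 2) ℂ :=
    MvPolynomial.C Complex.I * (MvPolynomial.X 0 - MvPolynomial.C (c : ℂ))
  have hqe : ∀ x : Fin 2 → ℂ, MvPolynomial.eval x q = Complex.I * (x 0 - c) := by
    intro x; simp [q]
  have hq : ∀ x ∈ L, (MvPolynomial.eval x q).im = 0 := by
    intro x hx
    rw [hqe]; simp [hx.2.2]
  obtain ⟨b, hb⟩ : ∃ b, ∀ z ∈ ball (0:ℂ) 1, Complex.I * (f z - c) = b := by
    apply im_const (c := 0)
    · fun_prop
    · intro z hz
      have := hull_real hLc (h z hz) q hq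
      rw [hqe] at this
      simpa using this
  obtain ⟨b', hb'⟩ : ∃ b', ∀ z ∈ ball (0:ℂ) 1, f z = b' := by
    refine ⟨f 0, fun z hz => ?_⟩
    have e := (hb z hz).trans (hb 0 (by simp)).symm
    have := mul_left_cancel₀ Complex.I_ne_zero e
    simpa using this
  have hfib : ∀ z ∈ ball (0:ℂ) 1, ![b', g z] ∈ polyHull {x | x ∈ L ∧ x 0 = b'} := by
    intro z hz
    have := hull_fiber hLc (h z hz) q hq
    rw [hb' z hz] at this
    have e : {x | x ∈ L ∧ x 0 = b'} = {w ∈ L | MvPolynomial.eval w q =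
        MvPolynomial.eval ![b', g z] q} := by
      ext x
      simp only [hqe]
      simp [Complex.I_ne_zero]
    rw [e]
    exact this
  set M := {x | x ∈ L ∧ x 0 = b'} with hM
  have hMc : IsCompact M := hLc.inter_right (isClosed_eq (by fun_prop) (by fun_prop))
  set R := √(1 - ‖b'‖ ^ 2) with hR
  have hMR : ∀ x ∈ M, ‖x 1‖ = R := by
    intro x hx
    have : ‖x 0‖ ^ 2 + ‖x 1‖ ^ 2 = 1 := hx.1.1
    rw [hx.2] at this
    rw [hR, ← this]
    simp
  have hgc : ∃ d, ∀ z ∈ ball (0:ℂ) 1, g z = d := by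
    rcases (Real.sqrt_nonneg (1 - ‖b'‖ ^ 2)).eq_or_lt with h0 | hpos
    · refine ⟨0, fun z hz => ?_⟩
      have := hull_le (hfib z hz) (MvPolynomial.X 1) le_rfl
        (by intro w hw; simp [hMR w hw, hR, ← h0])
      simpa using this
    · rw [← hR] at hpos
      have hsq : R ^ 2 = 1 - ‖b'‖ ^ 2 := Real.sq_sqrt (Real.sqrt_pos.1 hpos).le
      obtain ⟨ζ, hζ, hMζ⟩ : ∃ ζ : ℂ, ‖ζ‖ = R ∧ ∀ x ∈ M, x 1 ≠ ζ := by
        by_cases hu : u = 1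
        · refine ⟨-(R : ℂ), by simp [abs_of_pos hpos], ?_⟩
          intro x hx e
          have := (h1 x).2 (hx.1.2.1.trans hu)
          have h2 := this.2.2
          rw [e] at h2
          simp at h2
          linarith
        · refine ⟨(R : ℂ), by simp [abs_of_pos hpos], ?_⟩
          intro x hx e
          apply hu
          rw [← hx.1.2.1]
          apply (h1 x).1
          refine ⟨hx.1.1, ?_, ?_⟩
          · rw [e]; simp
          · rw [e]; simpa using hpos.le
      apply norm_const hg (c := R)
      intro z hz
      simpa using hull_circle hMc hpos hMR hζ hMζ (hfib z hz)
  obtain ⟨d, hd⟩ := hgc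
  intro z hz w hw
  exact ⟨(hb' z hz).trans (hb' w hw).symm, (hd z hz).trans (hd w hw).symm⟩

theorem stmt4 :
    ∃ f₁ f₂ : (Fin 2 → ℂ) → ℝ, ContDiff ℝ (⊤ : ℕ∞) f₁ ∧ ContDiff ℝ (⊤ : ℕ∞) f₂ ∧
      graphR2 f₁ f₂ SphS3 ⊂ polyHull (graphR2 f₁ f₂ SphS3) ∧
      NoAnalyticDisk (polyHull (graphR2 f₁ f₂ SphS3)) := by
  obtain ⟨a, ha, hd, z0, hz0, hz0a⟩ := exists_a
  obtain ⟨ρ, hρ, hρ0, hρ1⟩ := exists_rho ha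
  have hf2 : ContDiff ℝ (⊤ : ℕ∞) (fun x : Fin 2 → ℂ => ρ x * (x 0).re) := by
    apply hρ.mul
    exact Complex.reCLM.contDiff.comp (contDiff_apply ℝ ℂ (0 : Fin 2))
  refine ⟨ρ, fun x => ρ x * (x 0).re, hρ, hf2, ?_, ?_⟩
  · have hG := graph_compact hρ.continuous hf2.continuous
    refine (Set.ssubset_iff_of_subset (sub_hull hG)).2 ?_
    obtain ⟨s0, hs0⟩ := val_exists a z0
    refine ⟨Fin.append ![z0, full s0] ![(0:ℂ), 0], ?_, ?_⟩
    · apply hull_mono hG _ (hull_embed (in_hull ha hs0 hz0a hz0))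
      rintro _ ⟨x, hx, rfl⟩
      refine ⟨x, hx.2, ?_⟩
      have := (hρ0 x).1 hx
      simp [this]
    · rintro ⟨x, hx, e⟩
      have e0 : x 0 = z0 := by
        have := congrFun e (Fin.castAdd 2 0)
        simp only [Fin.append_left] at this
        exact this
      have e1 : x 1 = full s0 := by
        have := congrFun e (Fin.castAdd 2 1)
        simp only [Fin.append_left] at this
        exact this
      have hx' : ‖x 0‖ ^ 2 + ‖x 1‖ ^ 2 = 1 := hx
      rw [e0, e1] at hx'
      have h1 := full_near ha (by linarith) hs0
      have h2 : ‖full s0‖ ≤ 3 / 4 := by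
        have h3 := norm_sub_le (full s0 + 1 / 2) (1 / 2)
        have h4 : ‖(1 / 2 : ℂ)‖ = 1 / 2 := by norm_num
        rw [add_sub_cancel_right, h4] at h3
        linarith
      nlinarith [norm_nonneg z0, norm_nonneg (full s0)]
  · set G := graphR2 ρ (fun x => ρ x * (x 0).re) SphS3 with hGdef
    have hG : IsCompact G := graph_compact hρ.continuous hf2.continuous
    intro φ hφ hφG
    have hφd : ∀ i, DifferentiableOn ℂ (fun z => φ z i) (ball (0:ℂ) 1) :=
      fun i => (differentiableOn_pi.1 hφ) i
    have hG2 : ∀ w ∈ G, (MvPolynomial.eval w (MvPolynomial.X (2 : Fin (2 + 2)))).im = 0 := by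
      rintro _ ⟨x, hx, rfl⟩
      have : (2 : Fin (2 + 2)) = Fin.natAdd 2 0 := rfl
      rw [MvPolynomial.eval_X, this]; simp only [Fin.append_right]; simp
    have hG3 : ∀ w ∈ G, (MvPolynomial.eval w (MvPolynomial.X (3 : Fin (2 + 2)))).im = 0 := by
      rintro _ ⟨x, hx, rfl⟩
      have : (3 : Fin (2 + 2)) = Fin.natAdd 2 1 := rfl
      rw [MvPolynomial.eval_X, this]; simp only [Fin.append_right]; simp
    obtain ⟨u, hu⟩ := im_const (hφd 2) (c := 0) (fun z hz => by
      simpa using hull_real hG (hφG z hz) _ hG2)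
    obtain ⟨v, hv⟩ := im_const (hφd 3) (c := 0) (fun z hz => by
      simpa using hull_real hG (hφG z hz) _ hG3)
    have hL : ∀ z ∈ ball (0:ℂ) 1, ![φ z 0, φ z 1] ∈
        polyHull {x | x ∈ SphS3 ∧ (ρ x : ℂ) = u ∧ ((ρ x * (x 0).re : ℝ) : ℂ) = v} := by
      intro z hz
      have h1 := hull_fiber hG (hφG z hz) _ hG2
      have hG' : IsCompact {w ∈ G | MvPolynomial.eval w (MvPolynomial.X (2 : Fin (2 + 2)))
          = MvPolynomial.eval (φ z) (MvPolynomial.X (2 : Fin (2 + 2)))} :=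
        hG.inter_right (isClosed_eq (cont_eval _) continuous_const)
      have h2 := hull_fiber hG' h1 _ (fun w hw => hG3 w hw.1)
      have h3 := hull_rename (Fin.castAdd 2 : Fin 2 → Fin (2 + 2)) h2
      convert h3 using 1
      · congr 1
        ext x
        constructor
        · rintro ⟨hx, h4, h5⟩
          refine ⟨Fin.append x ![((ρ x : ℝ) : ℂ), ((ρ x * (x 0).re : ℝ) : ℂ)],
            ⟨⟨⟨x, hx, rfl⟩, ?_⟩, ?_⟩, ?_⟩
          · rw [MvPolynomial.eval_X, MvPolynomial.eval_X, hu z hz, ← h4]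
            exact Fin.append_right x _ (0 : Fin 2)
          · rw [MvPolynomial.eval_X, MvPolynomial.eval_X, hv z hz, ← h5]
            exact Fin.append_right x _ (1 : Fin 2)
          · funext i
            exact Fin.append_left x _ i
        · rintro ⟨_, ⟨⟨⟨x', hx, rfl⟩, h4⟩, h5⟩, rfl⟩
          have ex : (fun w : Fin (2 + 2) → ℂ => w ∘ (Fin.castAdd 2 : Fin 2 → Fin (2 + 2)))
            (Fin.append x' ![((ρ x' : ℝ) : ℂ), ((ρ x' * (x' 0).re : ℝ) : ℂ)]) = x' := by
            funext i
            exact Fin.append_left x' _ i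
          have hx2 : (x' ∈ SphS3 ∧ (ρ x' : ℂ) = u ∧ ((ρ x' * (x' 0).re : ℝ) : ℂ) = v) := by
            refine ⟨hx, ?_, ?_⟩
            · rw [MvPolynomial.eval_X, MvPolynomial.eval_X, hu z hz] at h4
              rw [← h4]
              exact (Fin.append_right x' ![((ρ x' : ℝ) : ℂ), ((ρ x' * (x' 0).re : ℝ) : ℂ)] (0 : Fin 2)).symm
            · rw [MvPolynomial.eval_X, MvPolynomial.eval_X, hv z hz] at h5
              rw [← h5]
              exact (Fin.append_right x' ![((ρ x' : ℝ) : ℂ), ((ρ x' * (x' 0).re : ℝ) : ℂ)] (1 : Fin 2)).symm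
          rw [← ex] at hx2
          exact hx2
      · funext i; fin_cases i <;> rfl
    have key : ∀ z ∈ ball (0:ℂ) 1, ∀ w ∈ ball (0:ℂ) 1, φ z 0 = φ w 0 ∧ φ z 1 = φ w 1 := by
      by_cases hu0 : u = 0
      · apply EE_no_disc ha hd (hφd 0) (hφd 1).continuousOn
        intro z hz
        apply hull_sub ha
        apply hull_mono (XX_compact ha) _ (hL z hz)
        rintro x ⟨-, h4, -⟩
        apply (hρ0 x).2
        rw [hu0] at h4
        exact_mod_cast h4
      · apply fiber_case hρ.continuous hρ1 (u := u.re) (c := v.re / u.re) (hφd 0) (hφd 1)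
        intro z hz
        refine hull_mono ?_ ?_ (hL z hz)
        · apply sph_compact.inter_right
          have := hρ.continuous
          exact (isClosed_eq (by fun_prop) (by fun_prop)).inter
            (isClosed_eq (by fun_prop) (by fun_prop))
        · rintro x ⟨hx, h4, h5⟩
          have h6 : ρ x = u.re := by rw [← h4]; simp
          have h7 : ρ x * (x 0).re = v.re := by rw [← h5]; simp only [Complex.ofReal_re]
          have h8 : u.re ≠ 0 := by
            intro h9
            apply hu0
            rw [← h4, h6, h9]; simp
          refine ⟨hx, h6, ?_⟩
          rw [eq_div_iff h8, ← h7, h6]; ring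
    intro z hz w hw
    funext i
    fin_cases i
    · exact (key z hz w hw).1
    · exact (key z hz w hw).2
    · exact (hu z hz).trans (hu w hw).symm
    · exact (hv z hz).trans (hv w hw).symm
end
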